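/- Let H = ℓ²(ℕ, ℍ), m ∈ 𝕊, and let N ∈ B(H) be a bounded right linear normal operator. Let K ⊆ ℂ_m^+ be a compact set contained in a curve of finite length, and assume that the spherical spectrum of N is the circularization of K: σ_S(N) = Ω_K. Then for every ε > 0 there exist a diagonal operator D ∈ B(H) and a Hilbert–Schmidt operator S ∈ B(H) with Hilbert–Schmidt norm ‖S‖₂ < ε such that N = D + S. -/

import Mathlib

noncomputable section

open Quaternion Filter Topology

/-- The division ring `ℍ` of real quaternions. -/
abbrev Hq := Quaternion ℝ

/-- The quaternionic Hilbert space `H = ℓ²(ℕ, ℍ)`. -/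
abbrev Hsp := lp (fun _ : ℕ => Hq) 2

/-- Right scalar multiplication `x ↦ x · q` on `ℓ²(ℕ, ℍ)` (coordinatewise right
multiplication by the quaternion `q`). -/
def rsmul (q : Hq) (x : Hsp) : Hsp := MulOpposite.op q • x

/-- The quaternionic inner product `⟨x, y⟩ = ∑ₙ x̄ₙ yₙ`. -/
def qinner (x y : Hsp) : Hq := ∑' n, star (x n) * y n

/-- The set `𝕊` of unit imaginary quaternions. -/
def QS : Set Hq := {q | star q = -q ∧ ‖q‖ = 1}

/-- The slice complex plane `ℂ_m = {α + mβ : α, β ∈ ℝ}`. -/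
def sliceC (m : Hq) : Set Hq := {q | ∃ α β : ℝ, q = (α : Hq) + m * (β : Hq)}

/-- The closed upper half slice plane `ℂ_m⁺ = {α + mβ : α ∈ ℝ, β ≥ 0}`. -/
def sliceCplus (m : Hq) : Set Hq :=
  {q | ∃ α β : ℝ, 0 ≤ β ∧ q = (α : Hq) + m * (β : Hq)}

/-- `T : H → H` is a bounded right linear operator, i.e. `T ∈ B(H)`. -/
def IsBoundedRightLinear (T : Hsp → Hsp) : Prop :=
  (∀ x y, T (x + y) = T x + T y) ∧ (∀ q x, T (rsmul q x) = rsmul q (T x)) ∧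
    ∃ M : ℝ, ∀ x, ‖T x‖ ≤ M * ‖x‖

/-- `S` is the adjoint of the (bounded) operator `T`: `⟨y, Tx⟩ = ⟨Sy, x⟩` for all `x, y`. -/
def AdjointOf (T S : Hsp → Hsp) : Prop := ∀ x y, qinner y (T x) = qinner (S y) x

/-- `T` is anti self-adjoint: `T* = -T`. -/
def IsAntiSelfAdjoint (T : Hsp → Hsp) : Prop := AdjointOf T (fun x => -(T x))

/-- `T` is unitary: `T*T = TT* = I`. -/
def IsUnitaryOp (T : Hsp → Hsp) : Prop :=
  ∃ S, AdjointOf T S ∧ (∀ x, S (T x) = x) ∧ (∀ x, T (S x) = x)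

/-- The slice Hilbert space `H₊^{Jm} = {u ∈ H : Ju = um}`. -/
def Hplus (J : Hsp → Hsp) (m : Hq) : Set Hsp := {u | J u = rsmul m u}

/-- `H₋^{Jm} = {u ∈ H : Ju = -um}`. -/
def Hminus (J : Hsp → Hsp) (m : Hq) : Set Hsp := {u | J u = -(rsmul m u)}

/-- `e` is an orthonormal basis of the (closed subspace given by the) set `S`:
each `e r` lies in `S`, the `e r` are orthonormal, and every `x ∈ S` expands as
`x = ∑ᵣ (e r) ⟨e r, x⟩`. Taking `S = Set.univ` gives orthonormal bases of `H`. -/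
def IsONBasisOn (S : Set Hsp) (e : ℕ → Hsp) : Prop :=
  (∀ r, e r ∈ S) ∧ (∀ r s, qinner (e r) (e s) = if r = s then 1 else 0) ∧
    ∀ x ∈ S, HasSum (fun r => rsmul (qinner (e r) x) (e r)) x

/-- A (possibly unbounded) operator in `H`: a domain together with an assignment of
values (only the values on the domain are relevant). -/
structure QOp where
  dom : Set Hsp
  app : Hsp → Hsp

/-- The operator `T` is right linear: its domain is a right `ℍ`-submodule and `T`
is additive and right `ℍ`-homogeneous on it. -/
def QOp.IsRightLinear (T : QOp) : Prop :=
  (0 ∈ T.dom) ∧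
  (∀ x ∈ T.dom, ∀ y ∈ T.dom, x + y ∈ T.dom ∧ T.app (x + y) = T.app x + T.app y) ∧
  (∀ x ∈ T.dom, ∀ q : Hq, rsmul q x ∈ T.dom ∧ T.app (rsmul q x) = rsmul q (T.app x))

/-- `T` is densely defined. -/
def QOp.IsDenselyDefined (T : QOp) : Prop := Dense T.dom

/-- `T` is a closed operator: its graph is closed in `H × H`. -/
def QOp.IsClosedOp (T : QOp) : Prop :=
  IsClosed {p : Hsp × Hsp | p.1 ∈ T.dom ∧ p.2 = T.app p.1}

/-- `S` is the adjoint `T*` of `T`: the domain of `S` is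
`{y : x ↦ ⟨y, Tx⟩ is continuous on D(T)}` and `⟨y, Tx⟩ = ⟨Sy, x⟩` there. -/
def QOp.IsAdjointOf (T S : QOp) : Prop :=
  S.dom = {y | ContinuousOn (fun x => qinner y (T.app x)) T.dom} ∧
  ∀ y ∈ S.dom, ∀ x ∈ T.dom, qinner y (T.app x) = qinner (S.app y) x

/-- Composition `S ∘ T` of partial operators, with the natural domain. -/
def QOp.comp (S T : QOp) : QOp :=
  ⟨{x ∈ T.dom | T.app x ∈ S.dom}, fun x => S.app (T.app x)⟩

/-- Equality of partial operators: equal domains and equal values on the domain. -/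
def QOp.Eq (A B : QOp) : Prop := A.dom = B.dom ∧ ∀ x ∈ A.dom, A.app x = B.app x

/-- `T` is normal: `T*T = TT*` (including equality of the domains). -/
def QOp.IsNormal (T : QOp) : Prop :=
  ∃ S : QOp, T.IsAdjointOf S ∧ QOp.Eq (S.comp T) (T.comp S)

/-- `T` is compact (as an operator on the subspace `S` of `H`): the image of the
closed unit ball of `S` is relatively compact. -/
def IsCompactOn (T : Hsp → Hsp) (S : Set Hsp) : Prop :=
  IsCompact (closure (T '' (Metric.closedBall 0 1 ∩ S)))

/-- `T` has squared Hilbert–Schmidt norm `v` on the subspace `S`: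
`∑ᵣ ‖T eᵣ‖² = v` for some orthonormal basis `e` of `S`. -/
def HasHSNormSqOn (T : Hsp → Hsp) (S : Set Hsp) (v : ℝ) : Prop :=
  ∃ e : ℕ → Hsp, IsONBasisOn S e ∧ HasSum (fun r => ‖T (e r)‖ ^ 2) v

/-- `T` is diagonal: there are an orthonormal basis `{φᵣ}` of `H` contained in `D(T)`
and quaternions `qᵣ` with `Tφᵣ = φᵣ qᵣ`. -/
def QOp.IsDiagonal (T : QOp) : Prop :=
  ∃ e : ℕ → Hsp, IsONBasisOn Set.univ e ∧ (∀ r, e r ∈ T.dom) ∧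
    ∃ q : ℕ → Hq, ∀ r, T.app (e r) = rsmul (q r) (e r)

/-- The operator `Δ_q(N) = N² - N(q + q̄) + I|q|²` for a bounded operator `N`. -/
def sphDeltaB (N : Hsp → Hsp) (q : Hq) : Hsp → Hsp :=
  fun x => N (N x) - rsmul (q + star q) (N x) + rsmul ((normSq q : ℝ) : Hq) x

/-- `q` lies in the spherical resolvent of the bounded operator `N`. -/
def inSphResolventB (N : Hsp → Hsp) (q : Hq) : Prop :=
  (∀ x, sphDeltaB N q x = 0 → x = 0) ∧
  Dense (Set.range (sphDeltaB N q)) ∧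
  ∃ M : ℝ, ∀ x, ‖x‖ ≤ M * ‖sphDeltaB N q x‖

/-- The spherical spectrum of a bounded operator. -/
def sphSpectrumB (N : Hsp → Hsp) : Set Hq := {q | ¬ inSphResolventB N q}

/-- The domain `D(N²)` of the square of a partial operator. -/
def QOp.sqDom (N : QOp) : Set Hsp := {x ∈ N.dom | N.app x ∈ N.dom}

/-- The map underlying `Δ_q(N) = N² - N(q + q̄) + I|q|²`, defined on `D(N²)`. -/
def sphDeltaU (N : QOp) (q : Hq) : Hsp → Hsp :=
  fun x => N.app (N.app x) - rsmul (q + star q) (N.app x) + rsmul ((normSq q : ℝ) : Hq) x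

/-- `q` lies in the spherical resolvent of the operator `N ∈ C(H)`. -/
def inSphResolventU (N : QOp) (q : Hq) : Prop :=
  (∀ x ∈ N.sqDom, sphDeltaU N q x = 0 → x = 0) ∧
  Dense (sphDeltaU N q '' N.sqDom) ∧
  ∃ M : ℝ, ∀ x ∈ N.sqDom, ‖x‖ ≤ M * ‖sphDeltaU N q x‖

/-- The spherical spectrum of `N ∈ C(H)`. -/
def sphSpectrumU (N : QOp) : Set Hq := {q | ¬ inSphResolventU N q}

/-- The circularization `Ω_K = {α + jβ : α + mβ ∈ K, j ∈ 𝕊}` of `K ⊆ ℂ_m`. -/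
def circ (m : Hq) (K : Set Hq) : Set Hq :=
  {p | ∃ α β : ℝ, ∃ j ∈ QS, ((α : Hq) + m * (β : Hq) ∈ K) ∧ p = (α : Hq) + j * (β : Hq)}

section Haar
open scoped InnerProductSpace

variable {E : Type*} [NormedAddCommGroup E] [InnerProductSpace ℂ E]

/-- The Haar system attached to a dyadic tree `v` of vectors. -/
def haarSystem (v : ℕ → ℕ → E) : ℕ × ℕ → E
  | (0, j) => v 0 j
  | (k + 1, j) => ((‖v (k + 1) (2 * j + 1)‖ : ℂ) ^ 2) • v (k + 1) (2 * j)
      - ((‖v (k + 1) (2 * j)‖ : ℂ) ^ 2) • v (k + 1) (2 * j + 1)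

variable {v : ℕ → ℕ → E}

theorem haarSystem_mem_span (k j : ℕ) :
    haarSystem v (k, j) ∈ Submodule.span ℂ (Set.range (v k)) := by
  cases k with
  | zero => exact Submodule.subset_span ⟨j, rfl⟩
  | succ k =>
    exact Submodule.sub_mem _ (Submodule.smul_mem _ _ (Submodule.subset_span ⟨_, rfl⟩))
      (Submodule.smul_mem _ _ (Submodule.subset_span ⟨_, rfl⟩))

theorem span_tree_mono (hsplit : ∀ k j, v k j = v (k + 1) (2 * j) + v (k + 1) (2 * j + 1)) :
    Monotone fun k => Submodule.span ℂ (Set.range (v k)) := by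
  refine monotone_nat_of_le_succ fun k => Submodule.span_le.2 ?_
  rintro _ ⟨j, rfl⟩
  rw [hsplit]
  exact Submodule.add_mem _ (Submodule.subset_span ⟨_, rfl⟩) (Submodule.subset_span ⟨_, rfl⟩)

theorem inner_tree_haarSystem_succ
    (hsplit : ∀ k j, v k j = v (k + 1) (2 * j) + v (k + 1) (2 * j + 1))
    (horth : ∀ k j j', j ≠ j' → ⟪v k j, v k j'⟫_ℂ = 0) (k j i : ℕ) :
    ⟪v k i, haarSystem v (k + 1, j)⟫_ℂ = 0 := by
  simp only [haarSystem]
  rw [hsplit k i]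
  simp only [inner_add_left, inner_sub_right, inner_smul_right]
  rw [horth (k + 1) (2 * i) (2 * j + 1) (by omega), horth (k + 1) (2 * i + 1) (2 * j) (by omega)]
  by_cases hij : i = j
  · subst hij
    rw [inner_self_eq_norm_sq_to_K, inner_self_eq_norm_sq_to_K]
    simp
    ring
  · rw [horth (k + 1) (2 * i) (2 * j) (by omega),
      horth (k + 1) (2 * i + 1) (2 * j + 1) (by omega)]
    simp

theorem inner_haarSystem_of_lt
    (hsplit : ∀ k j, v k j = v (k + 1) (2 * j) + v (k + 1) (2 * j + 1))
    (horth : ∀ k j j', j ≠ j' → ⟪v k j, v k j'⟫_ℂ = 0) {k l : ℕ} (hkl : k < l) (j i : ℕ) :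
    ⟪haarSystem v (k, j), haarSystem v (l, i)⟫_ℂ = 0 := by
  obtain ⟨l, rfl⟩ : ∃ l', l = l' + 1 := ⟨l - 1, by omega⟩
  have h := span_tree_mono hsplit (Nat.lt_succ_iff.1 hkl) (haarSystem_mem_span k j)
  generalize haarSystem v (k, j) = w at h
  induction h using Submodule.span_induction with
  | mem x hx =>
    obtain ⟨a, rfl⟩ := hx
    exact inner_tree_haarSystem_succ hsplit horth l i a
  | zero => simp
  | add x y _ _ hx hy => rw [inner_add_left, hx, hy, add_zero]
  | smul c x _ hx => rw [inner_smul_left, hx, mul_zero]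

theorem pairwise_inner_haarSystem
    (hsplit : ∀ k j, v k j = v (k + 1) (2 * j) + v (k + 1) (2 * j + 1))
    (horth : ∀ k j j', j ≠ j' → ⟪v k j, v k j'⟫_ℂ = 0) {a b : ℕ × ℕ} (hab : a ≠ b) :
    ⟪haarSystem v a, haarSystem v b⟫_ℂ = 0 := by
  obtain ⟨k, j⟩ := a
  obtain ⟨l, i⟩ := b
  rcases lt_trichotomy k l with h | rfl | h
  · exact inner_haarSystem_of_lt hsplit horth h j i
  · have hji : j ≠ i := fun h => hab (by rw [h])
    cases k with
    | zero => exact horth 0 j i hji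
    | succ k =>
      simp only [haarSystem, inner_sub_left, inner_sub_right, inner_smul_left, inner_smul_right]
      rw [horth (k + 1) (2 * j) (2 * i) (by omega), horth (k + 1) (2 * j) (2 * i + 1) (by omega),
        horth (k + 1) (2 * j + 1) (2 * i) (by omega),
        horth (k + 1) (2 * j + 1) (2 * i + 1) (by omega)]
      simp
  · rw [← inner_conj_symm, inner_haarSystem_of_lt hsplit horth h i j, map_zero]

theorem tree_mem_span_haarSystem
    (hsplit : ∀ k j, v k j = v (k + 1) (2 * j) + v (k + 1) (2 * j + 1)) (k j : ℕ) :
    v k j ∈ Submodule.span ℂ (Set.range (haarSystem v)) := by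
  induction k generalizing j with
  | zero => exact Submodule.subset_span ⟨(0, j), rfl⟩
  | succ k ih =>
    have key : ∀ j, v (k + 1) (2 * j) ∈ Submodule.span ℂ (Set.range (haarSystem v)) ∧
        v (k + 1) (2 * j + 1) ∈ Submodule.span ℂ (Set.range (haarSystem v)) := by
      intro j
      set P := Submodule.span ℂ (Set.range (haarSystem v))
      have hh : haarSystem v (k + 1, j) ∈ P := Submodule.subset_span ⟨_, rfl⟩
      have hv : v k j ∈ P := ih j
      have h0 : v (k + 1) (2 * j) ∈ P := by
        set a : ℝ := ‖v (k + 1) (2 * j)‖ with ha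
        set b : ℝ := ‖v (k + 1) (2 * j + 1)‖ with hb
        by_cases hz : a ^ 2 + b ^ 2 = 0
        · have : a = 0 := by nlinarith [sq_nonneg a, sq_nonneg b]
          rw [norm_eq_zero.1 this]
          exact zero_mem _
        · have e : ((a : ℂ) ^ 2 + (b : ℂ) ^ 2) • v (k + 1) (2 * j)
              = haarSystem v (k + 1, j) + ((a : ℂ) ^ 2) • v k j := by
            simp only [haarSystem]
            rw [← ha, ← hb, hsplit k j]
            module
          have hz' : (a : ℂ) ^ 2 + (b : ℂ) ^ 2 ≠ 0 := by exact_mod_cast hz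
          have : v (k + 1) (2 * j) = ((a : ℂ) ^ 2 + (b : ℂ) ^ 2)⁻¹ •
              (haarSystem v (k + 1, j) + ((a : ℂ) ^ 2) • v k j) := by
            rw [← e, smul_smul, inv_mul_cancel₀ hz', one_smul]
          rw [this]
          exact P.smul_mem _ (P.add_mem hh (P.smul_mem _ hv))
      refine ⟨h0, ?_⟩
      have : v (k + 1) (2 * j + 1) = v k j - v (k + 1) (2 * j) := by rw [hsplit k j]; abel
      rw [this]
      exact P.sub_mem hv h0
    rcases Nat.even_or_odd' j with ⟨c, rfl | rfl⟩
    · exact (key c).1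
    · exact (key c).2

end Haar

section CyclicModel
open MeasureTheory
open scoped InnerProductSpace

variable {E : Type*} [NormedAddCommGroup E] [InnerProductSpace ℂ E] [CompleteSpace E]
  {X : Type*} [MetricSpace X] [CompactSpace X] [MeasurableSpace X] [BorelSpace X]

/-- A vector `u` and a `*`-representation `Φ` of `C(X)` give a finite measure on `X` with
`‖Φ f u‖² = ∫ ‖f‖²`. -/
theorem exists_measure_norm_sq (Φ : C(X, ℂ) →⋆ₐ[ℂ] (E →L[ℂ] E)) (u : E) :
    ∃ μ : Measure X, IsFiniteMeasure μ ∧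
      ∀ f : C(X, ℂ), ‖Φ f u‖ ^ 2 = ∫ x, ‖f x‖ ^ 2 ∂μ := by
  let ι : C(X, ℝ) → C(X, ℂ) := fun f => ⟨fun x => (f x : ℂ), by fun_prop⟩
  have hsq : ∀ f : C(X, ℂ), (⟪u, Φ (star f * f) u⟫_ℂ).re = ‖Φ f u‖ ^ 2 := by
    intro f
    rw [map_mul, map_star, mul_apply_eq_comp, ContinuousLinearMap.star_eq_adjoint,
      ContinuousLinearMap.adjoint_inner_right, inner_self_eq_norm_sq_to_K]
    norm_cast
  let Λ₀ : CompactlySupportedContinuousMap X ℝ →ₗ[ℝ] ℝ :=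
    { toFun := fun f => (⟪u, Φ (ι f) u⟫_ℂ).re
      map_add' := fun f g => by
        have : ι (f + g : CompactlySupportedContinuousMap X ℝ) = ι f + ι g := by
          ext x; simp [ι]
        rw [this]; simp
      map_smul' := fun c f => by
        have : ι (c • f : CompactlySupportedContinuousMap X ℝ) = (c : ℂ) • ι f := by
          ext x; simp [ι]
        rw [this, map_smul, smul_apply, inner_smul_right]
        simp }
  let Λ : CompactlySupportedContinuousMap X ℝ →ₚ[ℝ] ℝ := PositiveLinearMap.mk₀ Λ₀ (by
    intro f hf
    let r : C(X, ℂ) := ⟨fun x => ((Real.sqrt (f x) : ℝ) : ℂ), by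
      have := f.continuous; fun_prop⟩
    have : ι f = star r * r := by
      ext x
      have hx : 0 ≤ f x := hf x
      simp only [ι, r, ContinuousMap.coe_mk, ContinuousMap.mul_apply, ContinuousMap.star_apply,
        RCLike.star_def, Complex.conj_ofReal]
      rw [← Complex.ofReal_mul, Real.mul_self_sqrt hx]
    change 0 ≤ (⟪u, Φ (ι f) u⟫_ℂ).re
    rw [this, hsq]
    positivity)
  refine ⟨RealRMK.rieszMeasure Λ, ?_, fun f => ?_⟩
  · infer_instance
  · let F : CompactlySupportedContinuousMap X ℝ :=
      ⟨⟨fun x => ‖f x‖ ^ 2, by fun_prop⟩, HasCompactSupport.of_compactSpace _⟩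
    have h := RealRMK.integral_rieszMeasure Λ F
    change ∫ x, ‖f x‖ ^ 2 ∂_ = (⟪u, Φ (ι F) u⟫_ℂ).re at h
    rw [h, ← hsq]
    congr 4
    ext x
    simp only [ι, F, ContinuousMap.coe_mk, ContinuousMap.mul_apply, ContinuousMap.star_apply,
      RCLike.star_def]
    rw [← Complex.normSq_eq_conj_mul_self, Complex.normSq_eq_norm_sq]
    rfl

/-- The cyclic subspace of `u` is isometric to an `L²` space, on which `Φ` acts by
multiplication. -/
theorem exists_cyclic_model (Φ : C(X, ℂ) →⋆ₐ[ℂ] (E →L[ℂ] E)) (u : E) :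
    ∃ (μ : Measure X) (_ : IsFiniteMeasure μ) (V : Lp ℂ 2 μ →L[ℂ] E),
      (∀ f : C(X, ℂ), ‖Φ f u‖ ^ 2 = ∫ x, ‖f x‖ ^ 2 ∂μ) ∧
      (∀ f, V (ContinuousMap.toLp 2 μ ℂ f) = Φ f u) ∧ (∀ φ, ‖V φ‖ = ‖φ‖) ∧
      ∀ (g : C(X, ℂ)) (φ : Lp ℂ 2 μ),
        Φ g (V φ) = V ((ContinuousMap.toLp ⊤ μ ℂ g : Lp ℂ ⊤ μ) • φ) := by
  obtain ⟨μ, hμ, h⟩ := exists_measure_norm_sq Φ u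
  have hdense : DenseRange (ContinuousMap.toLp 2 μ ℂ : C(X, ℂ) →L[ℂ] Lp ℂ 2 μ) :=
    ContinuousMap.toLp_denseRange ℂ μ ℂ (by simp)
  have hnorm : ∀ f : C(X, ℂ), ‖Φ f u‖ = ‖ContinuousMap.toLp 2 μ ℂ f‖ := by
    intro f
    rw [← sq_eq_sq₀ (norm_nonneg _) (norm_nonneg _), h]
    have e := inner_self_eq_norm_sq_to_K (𝕜 := ℂ) (ContinuousMap.toLp 2 μ ℂ f)
    rw [L2.inner_def] at e
    have e2 : ∫ x, ⟪(ContinuousMap.toLp 2 μ ℂ f) x, (ContinuousMap.toLp 2 μ ℂ f) x⟫_ℂ ∂μ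
        = ∫ x, ((‖f x‖ ^ 2 : ℝ) : ℂ) ∂μ := by
      refine integral_congr_ae ?_
      filter_upwards [ContinuousMap.coeFn_toLp (p := 2) (𝕜 := ℂ) μ f] with x hx
      rw [hx, inner_self_eq_norm_sq_to_K]
      norm_cast
    rw [e2] at e
    refine Complex.ofReal_injective
      (((integral_complex_ofReal (f := fun x => ‖f x‖ ^ 2) (μ := μ)).symm.trans e).trans ?_)
    simp
  let T : C(X, ℂ) →ₗ[ℂ] E :=
    { toFun := fun f => Φ f u
      map_add' := fun f g => by simp
      map_smul' := fun c f => by simp }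
  let V : Lp ℂ 2 μ →L[ℂ] E := T.extendOfNorm (ContinuousMap.toLp 2 μ ℂ).toLinearMap
  have hV : ∀ f, V (ContinuousMap.toLp 2 μ ℂ f) = Φ f u := fun f =>
    LinearMap.extendOfNorm_eq (f := T) (e := (ContinuousMap.toLp 2 μ ℂ).toLinearMap)
      hdense ⟨1, fun f => by rw [one_mul]; exact (hnorm f).le⟩ f
  refine ⟨μ, hμ, V, h, hV, ?_, ?_⟩
  · intro φ
    refine hdense.induction_on (p := fun φ => ‖V φ‖ = ‖φ‖) φ
      (isClosed_eq (by fun_prop) (by fun_prop)) fun f => ?_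
    rw [hV, hnorm]
  · intro g φ
    have hc : Continuous fun φ : Lp ℂ 2 μ =>
        ((ContinuousMap.toLp ⊤ μ ℂ g : Lp ℂ ⊤ μ) • φ : Lp ℂ 2 μ) :=
      AddMonoidHomClass.continuous_of_bound
        (AddMonoidHom.mk' (fun φ : Lp ℂ 2 μ =>
          ((ContinuousMap.toLp ⊤ μ ℂ g : Lp ℂ ⊤ μ) • φ : Lp ℂ 2 μ))
          (fun a b => Lp.add_smul _ a b)) ‖(ContinuousMap.toLp ⊤ μ ℂ g : Lp ℂ ⊤ μ)‖
        (fun x => Lp.norm_smul_le _ x)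
    refine hdense.induction_on (p := fun φ => Φ g (V φ) =
        V ((ContinuousMap.toLp ⊤ μ ℂ g : Lp ℂ ⊤ μ) • φ)) φ
      (isClosed_eq (by fun_prop) (V.continuous.comp hc)) fun f => ?_
    have : ((ContinuousMap.toLp ⊤ μ ℂ g : Lp ℂ ⊤ μ) • ContinuousMap.toLp 2 μ ℂ f : Lp ℂ 2 μ)
        = ContinuousMap.toLp 2 μ ℂ (g * f) := by
      refine Lp.ext ?_
      filter_upwards [Lp.coeFn_lpSMul (r := 2) (ContinuousMap.toLp ⊤ μ ℂ g : Lp ℂ ⊤ μ)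
        (ContinuousMap.toLp 2 μ ℂ f), ContinuousMap.coeFn_toLp (p := 2) (𝕜 := ℂ) μ f,
        ContinuousMap.coeFn_toLp (p := ⊤) (𝕜 := ℂ) μ g,
        ContinuousMap.coeFn_toLp (p := 2) (𝕜 := ℂ) μ (g * f)] with x h1 h2 h3 h4
      rw [h1, h4, Pi.smul_apply', h2, h3]
      rfl
    rw [this, hV, hV, map_mul]
    rfl

end CyclicModel

section DyadicPieces
open MeasureTheory
open scoped InnerProductSpace

variable {X : Type*} [MeasurableSpace X] {μ : Measure X} [IsFiniteMeasure μ]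
  {τ : X → ℝ}

theorem measurableSet_floor_eq (hτ : Measurable τ) (k j : ℕ) :
    MeasurableSet {x | ⌊2 ^ k * τ x⌋₊ = j} :=
  (Nat.measurable_floor.comp (hτ.const_mul _)) (measurableSet_singleton j)

variable (μ) in
/-- The indicator, in `L²(μ)`, of the piece of level `k` and index `j` of the dyadic subdivision
given by `τ`. -/
def dyadicInd (hτ : Measurable τ) (k j : ℕ) : Lp ℂ 2 μ :=
  indicatorConstLp 2 (measurableSet_floor_eq hτ k j) (measure_ne_top μ _) (1 : ℂ)

theorem floor_two_pow_succ (t : ℝ) (k : ℕ) :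
    ⌊2 ^ (k + 1) * t⌋₊ / 2 = ⌊2 ^ k * t⌋₊ := by
  rw [← Nat.floor_div_ofNat]
  congr 1
  rw [pow_succ]
  have : (OfNat.ofNat 2 : ℝ) = 2 := rfl
  rw [this]
  ring

theorem dyadicInd_split (hτ : Measurable τ) (k j : ℕ) :
    dyadicInd μ hτ k j = dyadicInd μ hτ (k + 1) (2 * j) + dyadicInd μ hτ (k + 1) (2 * j + 1) := by
  unfold dyadicInd
  rw [← indicatorConstLp_disjoint_union]
  · congr 1
    ext x
    have := floor_two_pow_succ (τ x) k
    simp only [Set.mem_ofPred_eq, Set.mem_union]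
    omega
  · rw [Set.disjoint_left]
    intro x h1 h2
    simp only [Set.mem_ofPred_eq] at h1 h2
    omega

theorem inner_dyadicInd (hτ : Measurable τ) (k j j' : ℕ) (h : j ≠ j') :
    ⟪dyadicInd μ hτ k j, dyadicInd μ hτ k j'⟫_ℂ = 0 := by
  unfold dyadicInd
  rw [L2.inner_indicatorConstLp_indicatorConstLp]
  have : {x | ⌊2 ^ k * τ x⌋₊ = j} ∩ {x | ⌊2 ^ k * τ x⌋₊ = j'} = ∅ := by
    ext x
    simp only [Set.mem_inter_iff, Set.mem_ofPred_eq, Set.mem_empty_iff_false, iff_false]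
    omega
  rw [this]
  simp

theorem dyadicInd_coeFn (hτ : Measurable τ) (k j : ℕ) :
    ∀ᵐ x ∂μ, dyadicInd μ hτ k j x = if ⌊2 ^ k * τ x⌋₊ = j then 1 else 0 := by
  filter_upwards [indicatorConstLp_coeFn (p := 2) (hs := measurableSet_floor_eq hτ k j)
    (hμs := measure_ne_top μ _) (c := (1 : ℂ))] with x hx
  rw [dyadicInd, hx, Set.indicator_apply]
  rfl

theorem haarSystem_dyadicInd_support (hτ : Measurable τ) (k j : ℕ) :
    ∀ᵐ x ∂μ, haarSystem (dyadicInd μ hτ) (k, j) x ≠ 0 → ⌊2 ^ (k - 1) * τ x⌋₊ = j := by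
  cases k with
  | zero =>
    filter_upwards [dyadicInd_coeFn (μ := μ) hτ 0 j] with x hx h
    simp only [haarSystem, hx] at h
    simpa using h
  | succ k =>
    simp only [haarSystem, Nat.add_sub_cancel]
    set a : ℂ := (‖dyadicInd μ hτ (k + 1) (2 * j + 1)‖ : ℂ) ^ 2
    set b : ℂ := (‖dyadicInd μ hτ (k + 1) (2 * j)‖ : ℂ) ^ 2
    filter_upwards [dyadicInd_coeFn (μ := μ) hτ (k + 1) (2 * j),
      dyadicInd_coeFn (μ := μ) hτ (k + 1) (2 * j + 1),
      Lp.coeFn_sub (a • dyadicInd μ hτ (k + 1) (2 * j)) (b • dyadicInd μ hτ (k + 1) (2 * j + 1)),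
      Lp.coeFn_smul a (dyadicInd μ hτ (k + 1) (2 * j)),
      Lp.coeFn_smul b (dyadicInd μ hτ (k + 1) (2 * j + 1))] with x h1 h2 h3 h4 h5 h
    rw [h3, Pi.sub_apply, h4, h5, Pi.smul_apply, Pi.smul_apply, h1, h2] at h
    have := floor_two_pow_succ (τ x) k
    by_contra hne
    apply h
    rw [if_neg (by omega), if_neg (by omega)]
    simp

theorem exists_step_mem_span (hτ : Measurable τ) (k : ℕ) (c : ℕ → ℂ) (M : ℕ) :
    ∃ g ∈ Submodule.span ℂ (Set.range (dyadicInd μ hτ k)),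
      ∀ᵐ x ∂μ, g x = if ⌊2 ^ k * τ x⌋₊ < M then c ⌊2 ^ k * τ x⌋₊ else 0 := by
  induction M with
  | zero =>
    refine ⟨0, zero_mem _, ?_⟩
    filter_upwards [Lp.coeFn_zero ℂ 2 μ] with x hx
    rw [hx]
    simp
  | succ M ih =>
    obtain ⟨g, hg, hgx⟩ := ih
    refine ⟨g + c M • dyadicInd μ hτ k M,
      Submodule.add_mem _ hg (Submodule.smul_mem _ _ (Submodule.subset_span ⟨M, rfl⟩)), ?_⟩
    filter_upwards [hgx, Lp.coeFn_add g (c M • dyadicInd μ hτ k M),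
      Lp.coeFn_smul (c M) (dyadicInd μ hτ k M), dyadicInd_coeFn (μ := μ) hτ k M] with x h1 h2 h3 h4
    rw [h2, Pi.add_apply, h3, Pi.smul_apply, h1, h4]
    rcases lt_trichotomy ⌊2 ^ k * τ x⌋₊ M with h | h | h
    · simp [h, h.ne, h.trans (Nat.lt_succ_self M)]
    · simp [h]
    · simp [h.ne', h.not_gt, show ¬ ⌊2 ^ k * τ x⌋₊ < M + 1 by omega]

end DyadicPieces

section HaarBlock
open MeasureTheory
open scoped InnerProductSpace ENNReal

variable {E : Type*} [NormedAddCommGroup E] [InnerProductSpace ℂ E] [CompleteSpace E]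
  {s : Set ℂ}

/-- The coordinate function on `s`. -/
def coordFun (s : Set ℂ) : C(s, ℂ) := ContinuousMap.restrict s (ContinuousMap.id ℂ)

/-- The positive part of the imaginary part, on `s`. -/
def imPos (s : Set ℂ) : C(s, ℂ) := ⟨fun z => ((max (z : ℂ).im 0 : ℝ) : ℂ), by fun_prop⟩

/-- The negative part of the imaginary part, on `s`. -/
def imNeg (s : Set ℂ) : C(s, ℂ) := ⟨fun z => ((max (-(z : ℂ).im) 0 : ℝ) : ℂ), by fun_prop⟩

/-- The subspace `{Φ f u}` generated by a vector `u` under a representation `Φ`. -/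
def cyclicSpan (Φ : C(s, ℂ) →⋆ₐ[ℂ] (E →L[ℂ] E)) (u : E) : Submodule ℂ E :=
  LinearMap.range ((LinearMap.applyₗ u).comp
    ((ContinuousLinearMap.coeLM ℂ).comp (Φ : C(s, ℂ) →ₐ[ℂ] (E →L[ℂ] E)).toLinearMap))

theorem abs_sub_le_one_of_floor_eq {a b : ℝ} (ha : 0 ≤ a) (hb : 0 ≤ b) (h : ⌊a⌋₊ = ⌊b⌋₊) :
    |a - b| ≤ 1 := by
  have h1 := Nat.floor_le ha
  have h2 := Nat.lt_floor_add_one a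
  have h3 := Nat.floor_le hb
  have h4 := Nat.lt_floor_add_one b
  rw [h] at h1 h2
  rw [abs_le]
  constructor <;> linarith

/-- The weight attached to the Haar vector of level `k` and index `j`. -/
def haarWeight (L : ℝ) (n : ℕ) (a : ℕ × ℕ) : ℝ :=
  if a.2 < n * 2 ^ (a.1 - 1) then L / (n * 2 ^ (a.1 - 1) : ℕ) else 0

theorem tsum_haarWeight_le {L : ℝ} {n : ℕ} (hn : 0 < n) :
    ∑' a, ENNReal.ofReal (haarWeight L n a ^ 2) ≤ ENNReal.ofReal (4 * L ^ 2 / n) := by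
  have inner : ∀ k, ∑' j, ENNReal.ofReal (haarWeight L n (k, j) ^ 2)
      ≤ ENNReal.ofReal (2 * L ^ 2 / n * (1 / 2) ^ k) := by
    intro k
    rw [tsum_eq_sum (s := Finset.range (n * 2 ^ (k - 1)))]
    · rw [← ENNReal.ofReal_sum_of_nonneg (fun _ _ => sq_nonneg _)]
      refine ENNReal.ofReal_le_ofReal ?_
      have : ∀ j ∈ Finset.range (n * 2 ^ (k - 1)),
          haarWeight L n (k, j) ^ 2 = (L / (n * 2 ^ (k - 1) : ℕ)) ^ 2 := by
        intro j hj
        rw [haarWeight, if_pos (Finset.mem_range.1 hj)]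
      rw [Finset.sum_congr rfl this, Finset.sum_const, Finset.card_range, nsmul_eq_mul]
      have hn' : (0 : ℝ) < n := by exact_mod_cast hn
      have hk : (2 : ℝ) ^ k ≤ 2 * 2 ^ (k - 1) := by
        rw [← pow_succ']
        exact pow_le_pow_right₀ (by norm_num) (by omega)
      push_cast
      have e1 : (n : ℝ) * 2 ^ (k - 1) * (L / (n * 2 ^ (k - 1))) ^ 2
          = L ^ 2 / n / 2 ^ (k - 1) := by
        field_simp
      have e2 : 2 * L ^ 2 / n * (1 / 2) ^ k = L ^ 2 / n * (2 / 2 ^ k) := by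
        rw [div_pow, one_pow]; ring
      rw [e1, e2, div_eq_mul_inv (L ^ 2 / n)]
      gcongr
      rw [inv_eq_one_div, div_le_div_iff₀ (by positivity) (by positivity)]
      linarith
    · intro j hj
      rw [haarWeight, if_neg (by simpa using hj)]
      simp
  rw [ENNReal.tsum_prod (f := fun k j => ENNReal.ofReal (haarWeight L n (k, j) ^ 2))]
  refine (ENNReal.tsum_le_tsum inner).trans ?_
  rw [← ENNReal.ofReal_tsum_of_nonneg (fun k => by positivity)
    (summable_geometric_two.mul_left _), tsum_mul_left, tsum_geometric_two]
  refine ENNReal.ofReal_le_ofReal (le_of_eq (by ring))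

theorem exists_haar_block [CompactSpace s] (Φ : C(s, ℂ) →⋆ₐ[ℂ] (E →L[ℂ] E)) (u : E)
    {θ : ℂ → ℝ} (hθm : Measurable θ) (h0 : ∀ z, 0 ≤ θ z) (h1 : ∀ z, θ z < 1) {L : ℝ} (hL : 0 ≤ L)
    (hθ : ∀ z ∈ s, ∀ w ∈ s, 0 ≤ z.im → 0 ≤ w.im → ‖z - w‖ ≤ L * |θ z - θ w|)
    (hu : Φ (imNeg s) u = 0) {ε : ℝ≥0∞} (hε : ε ≠ 0) :
    ∃ (w : ℕ × ℕ → E) (d : ℕ × ℕ → ℂ) (η : ℕ × ℕ → ℝ),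
      (∀ a b, a ≠ b → ⟪w a, w b⟫_ℂ = 0) ∧
      (∀ a, w a ∈ (cyclicSpan Φ u).topologicalClosure) ∧
      (∀ f, Φ f u ∈ (Submodule.span ℂ (Set.range w)).topologicalClosure) ∧
      (∀ a, ‖Φ (coordFun s) (w a) - d a • w a‖ ≤ η a * ‖w a‖) ∧
      ∑' a, ENNReal.ofReal (η a ^ 2) ≤ ε := by
  obtain ⟨μ, hμ, V, hV2, hVf, hVn, hVg⟩ := exists_cyclic_model Φ u
  have hdense : DenseRange (ContinuousMap.toLp 2 μ ℂ : C(s, ℂ) →L[ℂ] Lp ℂ 2 μ) :=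
    ContinuousMap.toLp_denseRange ℂ μ ℂ (by simp)
  have him : ∀ᵐ x : s ∂μ, 0 ≤ (x : ℂ).im := by
    have h := hV2 (imNeg s)
    rw [hu, norm_zero, zero_pow two_ne_zero, eq_comm, integral_eq_zero_iff_of_nonneg
      (fun x => sq_nonneg _)
      ((Continuous.integrable_of_hasCompactSupport ((imNeg s).continuous.norm.pow 2)
        (HasCompactSupport.of_compactSpace _)))] at h
    filter_upwards [h] with x hx
    simp only [imNeg, ContinuousMap.coe_mk, Pi.zero_apply, ne_eq, OfNat.ofNat_ne_zero,
      not_false_eq_true, pow_eq_zero_iff, norm_eq_zero, Complex.ofReal_eq_zero] at hx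
    have := le_max_left (-(x : ℂ).im) 0
    linarith
  obtain ⟨r, hr0, hrε⟩ := ENNReal.lt_iff_exists_nnreal_btwn.1 (pos_iff_ne_zero.2 hε)
  have hr : (0 : ℝ) < r := by exact_mod_cast hr0
  obtain ⟨n, hn⟩ := exists_nat_gt (4 * L ^ 2 / r)
  have hn0 : (0 : ℝ) < n := lt_of_le_of_lt (by positivity) hn
  have hn0' : 0 < n := by exact_mod_cast hn0
  let τ : s → ℝ := fun x => n * θ x
  have hτ : Measurable τ := (hθm.comp measurable_subtype_coe).const_mul _
  have hfl : ∀ (k : ℕ) (x : s), ⌊2 ^ k * τ x⌋₊ < n * 2 ^ k := by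
    intro k x
    rw [Nat.floor_lt (by have := h0 x; positivity)]
    push_cast
    simp only [τ]
    have := h1 x
    have : (0 : ℝ) < n * 2 ^ k := by positivity
    nlinarith [h1 x]
  have hdist : ∀ (k : ℕ) (x y : s), 0 ≤ (x : ℂ).im → 0 ≤ (y : ℂ).im →
      ⌊2 ^ k * τ x⌋₊ = ⌊2 ^ k * τ y⌋₊ → ‖(x : ℂ) - y‖ ≤ L / (n * 2 ^ k : ℕ) := by
    intro k x y hx hy hxy
    refine (hθ x x.2 y y.2 hx hy).trans ?_
    have := abs_sub_le_one_of_floor_eq (by have := h0 x; positivity)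
      (by have := h0 y; positivity) hxy
    have e : 2 ^ k * τ x - 2 ^ k * τ y = (n * 2 ^ k) * (θ x - θ y) := by simp only [τ]; ring
    rw [e, abs_mul, abs_of_pos (by positivity)] at this
    rw [div_eq_mul_inv, inv_eq_one_div]
    gcongr
    push_cast
    rw [le_div_iff₀ (by positivity)]
    linarith
  set v := dyadicInd μ hτ with hv
  have hsplit : ∀ k j, v k j = v (k + 1) (2 * j) + v (k + 1) (2 * j + 1) := dyadicInd_split hτ
  have horth : ∀ k j j', j ≠ j' → ⟪v k j, v k j'⟫_ℂ = 0 := inner_dyadicInd hτ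
  classical
  let sel : ℕ → ℕ → ℂ := fun k j =>
    if h : ∃ x : s, 0 ≤ (x : ℂ).im ∧ ⌊2 ^ k * τ x⌋₊ = j then h.choose else 0
  have hsel : ∀ k (x : s), 0 ≤ (x : ℂ).im →
      ∃ y : s, sel k ⌊2 ^ k * τ x⌋₊ = y ∧ ‖(x : ℂ) - y‖ ≤ L / (n * 2 ^ k : ℕ) := by
    intro k x hx
    have h : ∃ y : s, 0 ≤ (y : ℂ).im ∧ ⌊2 ^ k * τ y⌋₊ = ⌊2 ^ k * τ x⌋₊ := ⟨x, hx, rfl⟩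
    refine ⟨h.choose, ?_, hdist k x _ hx h.choose_spec.1 h.choose_spec.2.symm⟩
    simp only [sel]
    rw [dif_pos h]
  let Vi : Lp ℂ 2 μ →ₗᵢ[ℂ] E := ⟨V.toLinearMap, hVn⟩
  refine ⟨fun a => V (haarSystem v a), fun a => sel (a.1 - 1) a.2, haarWeight L n, ?_, ?_, ?_, ?_,
    (tsum_haarWeight_le hn0').trans ?_⟩
  · intro a b hab
    exact (Vi.inner_map_map _ _).trans (pairwise_inner_haarSystem hsplit horth hab)
  · intro a
    refine hdense.induction_on (p := fun φ => V φ ∈ (cyclicSpan Φ u).topologicalClosure) _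
      ((Submodule.isClosed_topologicalClosure _).preimage V.continuous) fun f => ?_
    refine Submodule.le_topologicalClosure _ ?_
    rw [hVf]
    exact ⟨f, rfl⟩
  · intro f
    have key : ContinuousMap.toLp 2 μ ℂ f ∈
        (Submodule.span ℂ (Set.range (haarSystem v))).topologicalClosure := by
      change _ ∈ closure _
      rw [Metric.mem_closure_iff]
      intro ρ hρ
      set C : ℝ := (measureUnivNNReal μ : ℝ) ^ (2 : ℝ≥0∞).toReal⁻¹ with hC
      have hC0 : 0 ≤ C := by positivity
      obtain ⟨δ, hδ, hfδ⟩ := Metric.uniformContinuous_iff.1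
        (CompactSpace.uniformContinuous_of_continuous f.continuous) (ρ / (C + 1)) (by positivity)
      obtain ⟨k, hk⟩ : ∃ k : ℕ, L / (n * 2 ^ k : ℕ) < δ := by
        obtain ⟨k, hk⟩ := pow_unbounded_of_one_lt (L / δ) (one_lt_two : (1 : ℝ) < 2)
        refine ⟨k, ?_⟩
        rw [div_lt_iff₀ (by positivity)]
        rw [div_lt_iff₀ hδ] at hk
        push_cast
        have : (1 : ℝ) ≤ n := by exact_mod_cast hn0'
        have : (2 : ℝ) ^ k * δ ≤ δ * (n * 2 ^ k) := by
          have : 0 < (2 : ℝ) ^ k * δ := by positivity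
          nlinarith
        linarith
      let c : ℕ → ℂ := fun j => if h : sel k j ∈ s then f ⟨sel k j, h⟩ else 0
      obtain ⟨g, hg, hgx⟩ := exists_step_mem_span (μ := μ) hτ k c (n * 2 ^ k)
      refine ⟨g, ?_, ?_⟩
      · refine (Submodule.span_le (p := Submodule.span ℂ (Set.range (haarSystem v)))).2 ?_ hg
        rintro _ ⟨j, rfl⟩
        exact tree_mem_span_haarSystem hsplit k j
      · rw [dist_eq_norm]
        refine (Lp.norm_le_of_ae_bound (C := ρ / (C + 1)) (by positivity) ?_).trans_lt ?_
        · filter_upwards [hgx, him, ContinuousMap.coeFn_toLp (p := 2) (𝕜 := ℂ) μ f,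
            Lp.coeFn_sub (ContinuousMap.toLp 2 μ ℂ f) g] with x h1 h2 h3 h4
          rw [h4, Pi.sub_apply, h3, h1, if_pos (hfl k x)]
          obtain ⟨y, hy, hxy⟩ := hsel k x h2
          have hcy : c ⌊2 ^ k * τ x⌋₊ = f y := by
            simp only [c]
            rw [dif_pos (by rw [hy]; exact y.2)]
            congr 1
            exact Subtype.ext hy
          rw [hcy, ← dist_eq_norm]
          refine (hfδ ?_).le
          rw [Subtype.dist_eq, dist_eq_norm]
          exact hxy.trans_lt hk
        · rw [← hC, mul_div_assoc', div_lt_iff₀ (by positivity)]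
          nlinarith
    have h := map_mem_closure V.continuous
      (t := Submodule.span ℂ (Set.range fun a => V (haarSystem v a)))
      key ?_
    · rw [hVf] at h
      exact h
    · intro x hx
      have : V x ∈ (Submodule.span ℂ (Set.range (haarSystem v))).map V.toLinearMap :=
        ⟨x, hx, rfl⟩
      rw [Submodule.map_span, ← Set.range_comp] at this
      exact this
  · rintro ⟨k, j⟩
    set φ := haarSystem v (k, j) with hφ
    set c := sel (k - 1) j with hc
    change ‖Φ (coordFun s) (V φ) - c • V φ‖ ≤ _ * ‖V φ‖
    rw [hVg, ← map_smul, ← map_sub, hVn, hVn]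
    refine Lp.norm_le_mul_norm_of_ae_le_mul ?_
    filter_upwards [Lp.coeFn_sub ((ContinuousMap.toLp ⊤ μ ℂ (coordFun s) : Lp ℂ ⊤ μ) • φ) (c • φ),
      Lp.coeFn_lpSMul (r := 2) (ContinuousMap.toLp ⊤ μ ℂ (coordFun s) : Lp ℂ ⊤ μ) φ,
      Lp.coeFn_smul c φ, ContinuousMap.coeFn_toLp (p := ⊤) (𝕜 := ℂ) μ (coordFun s),
      haarSystem_dyadicInd_support (μ := μ) hτ k j, him] with x e1 e2 e3 e4 e5 e6
    rw [e1, Pi.sub_apply, e2, e3, Pi.smul_apply', Pi.smul_apply, e4]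
    by_cases hφx : φ x = 0
    · rw [hφx]; simp
    · have hj := e5 hφx
      have hjlt := hfl (k - 1) x
      rw [hj] at hjlt
      rw [haarWeight, if_pos hjlt, ← sub_smul, norm_smul]
      gcongr
      obtain ⟨y, hy, hxy⟩ := hsel (k - 1) x e6
      rw [hj] at hy
      rw [hc, hy]
      exact hxy
  · refine le_trans ?_ hrε.le
    rw [← ENNReal.ofReal_coe_nnreal]
    refine ENNReal.ofReal_le_ofReal ?_
    rw [div_lt_iff₀ hr] at hn
    rw [div_le_iff₀ hn0]
    linarith

end HaarBlock

section QuaternionicStructure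
open scoped InnerProductSpace ENNReal ComplexConjugate CStarAlgebra

variable {E : Type*} [NormedAddCommGroup E] [InnerProductSpace ℂ E]

/-- A conjugate-linear isometry `R` with `R ∘ R = -1`. -/
structure IsQuatStructure (R : E →L⋆[ℂ] E) : Prop where
  apply_apply : ∀ x, R (R x) = -x
  inner_apply_apply : ∀ x y, ⟪R x, R y⟫_ℂ = ⟪y, x⟫_ℂ

namespace IsQuatStructure

variable {R : E →L⋆[ℂ] E}

theorem inner_apply_left (hR : IsQuatStructure R) (x y : E) : ⟪R x, y⟫_ℂ = -⟪R y, x⟫_ℂ := by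
  have h := hR.inner_apply_apply x (R y)
  rw [hR.apply_apply, inner_neg_right] at h
  rw [← h, neg_neg]

theorem inner_apply_right (hR : IsQuatStructure R) (x y : E) : ⟪x, R y⟫_ℂ = -⟪y, R x⟫_ℂ := by
  rw [← inner_conj_symm, hR.inner_apply_left, map_neg, inner_conj_symm]

theorem norm_apply (hR : IsQuatStructure R) (x : E) : ‖R x‖ = ‖x‖ := by
  rw [norm_eq_sqrt_re_inner (𝕜 := ℂ), hR.inner_apply_apply, ← norm_eq_sqrt_re_inner]

theorem eq_zero_of_inner (hR : IsQuatStructure R) {x : E} (h : ∀ y, ⟪R y, x⟫_ℂ = 0) : x = 0 := by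
  have := h (-R x)
  rw [map_neg, hR.apply_apply, neg_neg] at this
  exact inner_self_eq_zero.1 this

theorem apply_adjoint [CompleteSpace E] (hR : IsQuatStructure R) {T : E →L[ℂ] E}
    (hT : ∀ x, R (T x) = T (R x)) (x : E) : R (star T x) = star T (R x) := by
  refine sub_eq_zero.1 (hR.eq_zero_of_inner fun y => ?_)
  rw [inner_sub_right, hR.inner_apply_apply, ContinuousLinearMap.star_eq_adjoint,
    ContinuousLinearMap.adjoint_inner_left, ContinuousLinearMap.adjoint_inner_right, ← hT,
    hR.inner_apply_apply, sub_self]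

end IsQuatStructure

theorem countable_of_pairwise_inner_eq_zero [TopologicalSpace.SeparableSpace E] {S : Set E}
    (h0 : ∀ u ∈ S, u ≠ 0) (h : S.Pairwise fun u v => ⟪u, v⟫_ℂ = 0) : S.Countable := by
  refine Set.PairwiseDisjoint.countable_of_isOpen (s := fun u => Metric.ball u (‖u‖ / 2))
    (fun u hu v hv huv => ?_) (fun _ _ => Metric.isOpen_ball)
    fun u hu => ⟨u, Metric.mem_ball_self (half_pos (norm_pos_iff.2 (h0 u hu)))⟩
  refine Metric.ball_disjoint_ball ?_
  rw [dist_eq_norm]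
  have key : ‖u - v‖ * ‖u - v‖ = ‖u‖ * ‖u‖ + ‖v‖ * ‖v‖ := by
    have := norm_add_sq_eq_norm_sq_add_norm_sq_of_inner_eq_zero (𝕜 := ℂ) u (-v)
      (by rw [inner_neg_right, h hu hv huv, neg_zero])
    rwa [← sub_eq_add_neg, norm_neg] at this
  refine abs_le_of_sq_le_sq' ?_ (norm_nonneg _) |>.2
  nlinarith [sq_nonneg (‖u‖ - ‖v‖)]

variable [CompleteSpace E] {s : Set ℂ}

theorem continuous_starAlgHom_apply [CompactSpace s] (Φ : C(s, ℂ) →⋆ₐ[ℂ] (E →L[ℂ] E)) (x : E) :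
    Continuous fun f => Φ f x :=
  (ContinuousLinearMap.apply ℂ E x).continuous.comp (map_continuous Φ)

theorem inner_starAlgHom_left (Φ : C(s, ℂ) →⋆ₐ[ℂ] (E →L[ℂ] E)) (f : C(s, ℂ)) (x y : E) :
    ⟪Φ f x, y⟫_ℂ = ⟪x, Φ (star f) y⟫_ℂ := by
  rw [map_star, ContinuousLinearMap.star_eq_adjoint, ContinuousLinearMap.adjoint_inner_right]

theorem starAlgHom_mul_apply (Φ : C(s, ℂ) →⋆ₐ[ℂ] (E →L[ℂ] E)) (f g : C(s, ℂ)) (x : E) :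
    Φ f (Φ g x) = Φ (f * g) x := by
  rw [map_mul, mul_apply_eq_comp]

theorem starAlgHom_const_apply (Φ : C(s, ℂ) →⋆ₐ[ℂ] (E →L[ℂ] E)) (r : ℂ) (x : E) :
    Φ (ContinuousMap.const s r) x = r • x := by
  have : ContinuousMap.const s r = algebraMap ℂ C(s, ℂ) r := rfl
  rw [this, AlgHomClass.commutes, Algebra.algebraMap_eq_smul_one]
  rfl

/-- The function `z ↦ conj (f (conj z))`, for `c` the complex conjugation of `s`. -/
def sharp (c : C(s, s)) (f : C(s, ℂ)) : C(s, ℂ) := star (f.comp c)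

theorem quat_starAlgHom [CompactSpace s] {R : E →L⋆[ℂ] E} (hR : IsQuatStructure R)
    {Φ : C(s, ℂ) →⋆ₐ[ℂ] (E →L[ℂ] E)} (hΦ : ∀ x, R (Φ (coordFun s) x) = Φ (coordFun s) (R x))
    {c : C(s, s)} (hc : ∀ z, (c z : ℂ) = conj (z : ℂ)) (f : C(s, ℂ)) :
    ∀ x, R (Φ f x) = Φ (sharp c f) (R x) := by
  have hid : sharp c (coordFun s) = coordFun s := by
    ext z; simp [sharp, coordFun, hc]
  have hsid : sharp c (star (coordFun s)) = star (coordFun s) := by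
    ext z; simp [sharp, coordFun, hc]
  induction f using ContinuousMap.induction_on_of_compact with
  | const r =>
    intro x
    have : sharp c (ContinuousMap.const s r) = ContinuousMap.const s (conj r) := by
      ext z; simp [sharp]
    rw [this, starAlgHom_const_apply, starAlgHom_const_apply, map_smulₛₗ]
  | id =>
    intro x
    change R (Φ (coordFun s) x) = Φ (sharp c (coordFun s)) (R x)
    rw [hid, hΦ]
  | star_id =>
    intro x
    change R (Φ (star (coordFun s)) x) = Φ (sharp c (star (coordFun s))) (R x)
    rw [hsid, map_star]
    exact hR.apply_adjoint hΦ x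
  | add f g hf hg =>
    intro x
    have : sharp c (f + g) = sharp c f + sharp c g := by
      ext z; simp [sharp]
    rw [this, map_add, map_add, add_apply, add_apply, map_add, hf, hg]
  | mul f g hf hg =>
    intro x
    have : sharp c (f * g) = sharp c f * sharp c g := by
      ext z; simp [sharp]
    rw [this, ← starAlgHom_mul_apply, hf, hg, starAlgHom_mul_apply]
  | frequently f hf =>
    intro x
    have hcl : IsClosed {g : C(s, ℂ) | R (Φ g x) = Φ (sharp c g) (R x)} :=
      isClosed_eq (R.continuous.comp (continuous_starAlgHom_apply Φ x))
        ((continuous_starAlgHom_apply Φ (R x)).comp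
          (continuous_star.comp (ContinuousMap.continuous_precomp c)))
    exact hcl.closure_subset (mem_closure_iff_frequently.2 (hf.mono fun g hg => hg x))

theorem starAlgHom_comp_conj_apply [CompactSpace s] {Φ : C(s, ℂ) →⋆ₐ[ℂ] (E →L[ℂ] E)} {c : C(s, s)}
    (hc : ∀ z, (c z : ℂ) = conj (z : ℂ)) {y : E}
    (hy : Φ (star (coordFun s)) y = Φ (coordFun s) y) (f : C(s, ℂ)) :
    Φ (f.comp c) y = Φ f y := by
  have hid : (coordFun s).comp c = star (coordFun s) := by
    ext z; simp [coordFun, hc]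
  induction f using ContinuousMap.induction_on_of_compact with
  | const r => rfl
  | id =>
    change Φ ((coordFun s).comp c) y = Φ (coordFun s) y
    rw [hid, hy]
  | star_id =>
    change Φ (star ((coordFun s).comp c)) y = Φ (star (coordFun s)) y
    rw [hid, star_star, hy]
  | add f g hf hg =>
    rw [ContinuousMap.add_comp, map_add, map_add, add_apply, add_apply, hf, hg]
  | mul f g hf hg =>
    rw [ContinuousMap.mul_comp, ← starAlgHom_mul_apply, hg, starAlgHom_mul_apply, mul_comm,
      ← starAlgHom_mul_apply, hf, starAlgHom_mul_apply, mul_comm]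
  | frequently f hf =>
    have hcl : IsClosed {g : C(s, ℂ) | Φ (g.comp c) y = Φ g y} :=
      isClosed_eq ((continuous_starAlgHom_apply Φ y).comp (ContinuousMap.continuous_precomp c))
        (continuous_starAlgHom_apply Φ y)
    exact hcl.closure_subset (mem_closure_iff_frequently.2 hf)

/-- A vector supported on the closed upper half plane whose cyclic subspace is orthogonal to its
image under `R`. -/
def IsUpperVector (Φ : C(s, ℂ) →⋆ₐ[ℂ] (E →L[ℂ] E)) (R : E →L⋆[ℂ] E) (u : E) : Prop :=
  Φ (imNeg s) u = 0 ∧ ∀ f, ⟪R u, Φ f u⟫_ℂ = 0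

/-- `v` is orthogonal to the subspaces generated by `u` and by `R u`. -/
def CyclicOrtho (Φ : C(s, ℂ) →⋆ₐ[ℂ] (E →L[ℂ] E)) (R : E →L⋆[ℂ] E) (u v : E) : Prop :=
  ∀ f, ⟪Φ f u, v⟫_ℂ = 0 ∧ ⟪R (Φ f u), v⟫_ℂ = 0

variable {R : E →L⋆[ℂ] E} {Φ : C(s, ℂ) →⋆ₐ[ℂ] (E →L[ℂ] E)} {c : C(s, s)}

theorem isUpperVector_imPos
    (hΦ : ∀ f x, R (Φ f x) = Φ (sharp c f) (R x)) (hc : ∀ z, (c z : ℂ) = conj (z : ℂ)) (y : E) :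
    IsUpperVector Φ R (Φ (imPos s) y) := by
  have hzero : imNeg s * imPos s = 0 := by
    ext z
    rcases le_total (z : ℂ).im 0 with h | h <;> simp [imNeg, imPos, h]
  have hsharp : sharp c (imPos s) = imNeg s := by
    ext z; simp [sharp, imNeg, imPos, hc]
  have hstar : star (imNeg s) = imNeg s := by
    ext z; simp [imNeg]
  refine ⟨by rw [starAlgHom_mul_apply, hzero]; simp, fun f => ?_⟩
  rw [hΦ, hsharp, inner_starAlgHom_left, hstar, starAlgHom_mul_apply, starAlgHom_mul_apply,
    mul_right_comm, hzero, zero_mul]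
  simp

theorem exists_isUpperVector [CompactSpace s] (hR : IsQuatStructure R)
    (hΦ : ∀ f x, R (Φ f x) = Φ (sharp c f) (R x)) (hc : ∀ z, (c z : ℂ) = conj (z : ℂ))
    {y : E} (hy : y ≠ 0) :
    ∃ v, v ≠ 0 ∧ IsUpperVector Φ R v ∧
      ((∃ f, v = Φ f y) ∨ ∃ f, v = Φ f (R y)) := by
  by_cases h1 : Φ (imPos s) y = 0
  swap
  · exact ⟨_, h1, isUpperVector_imPos hΦ hc y, Or.inl ⟨_, rfl⟩⟩
  by_cases h2 : Φ (imPos s) (R y) = 0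
  swap
  · exact ⟨_, h2, isUpperVector_imPos hΦ hc (R y), Or.inr ⟨_, rfl⟩⟩
  have h3 : Φ (imNeg s) y = 0 := by
    have hsharp : sharp c (imPos s) = imNeg s := by
      ext z; simp [sharp, imNeg, imPos, hc]
    have h := hΦ (imPos s) (R y)
    rw [h2, map_zero, hR.apply_apply, hsharp, map_neg, zero_eq_neg] at h
    exact h
  have h4 : Φ (star (coordFun s)) y = Φ (coordFun s) y := by
    have : star (coordFun s) = coordFun s
        + ContinuousMap.const s (-2 * Complex.I) * (imPos s + (-1 : ℂ) • imNeg s) := by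
      ext z
      have : ((max (z : ℂ).im 0 : ℝ) : ℂ) - (max (-(z : ℂ).im) 0 : ℝ) = ((z : ℂ).im : ℂ) := by
        rw [← Complex.ofReal_sub, max_zero_sub_max_neg_zero_eq_self]
      simp only [ContinuousMap.star_apply, coordFun, ContinuousMap.restrict_apply,
        ContinuousMap.id_apply, ContinuousMap.add_apply, ContinuousMap.mul_apply,
        ContinuousMap.const_apply, ContinuousMap.smul_apply, imPos, imNeg, ContinuousMap.coe_mk,
        smul_eq_mul, neg_one_mul, ← sub_eq_add_neg, this]
      apply Complex.ext <;> simp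
      ring
    rw [this, map_add, add_apply, ← starAlgHom_mul_apply, map_add, map_smul, add_apply, smul_apply,
      h1, h3]
    simp
  refine ⟨y, hy, ⟨h3, fun f => ?_⟩, Or.inl ⟨1, by simp⟩⟩
  have key : ⟪R y, Φ f y⟫_ℂ = -⟪R y, Φ f y⟫_ℂ := by
    conv_lhs => rw [hR.inner_apply_left, hΦ, inner_starAlgHom_left]
    have : star (sharp c f) = f.comp c := star_star _
    rw [this, starAlgHom_comp_conj_apply hc h4]
  exact self_eq_neg.1 key

namespace CyclicOrtho

theorem starAlgHom_right (hΦ : ∀ f x, R (Φ f x) = Φ (sharp c f) (R x))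
    (hc : ∀ z, (c z : ℂ) = conj (z : ℂ)) {u v : E} (h : CyclicOrtho Φ R u v) (g : C(s, ℂ)) :
    CyclicOrtho Φ R u (Φ g v) := by
  intro f
  have hg : sharp c (sharp c (star g)) = star g := by
    ext z
    have : c (c z) = z := Subtype.ext (by rw [hc, hc, Complex.conj_conj])
    simp [sharp, this]
  refine ⟨?_, ?_⟩
  · have := (h (star g * f)).1
    rwa [← starAlgHom_mul_apply, inner_starAlgHom_left, star_star] at this
  · have := (h (sharp c (star g) * f)).2
    rwa [← starAlgHom_mul_apply, hΦ, hg, inner_starAlgHom_left, star_star] at this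

theorem quat_right (hR : IsQuatStructure R) {u v : E} (h : CyclicOrtho Φ R u v) :
    CyclicOrtho Φ R u (R v) := by
  intro f
  refine ⟨?_, ?_⟩
  · rw [hR.inner_apply_right, ← inner_conj_symm, (h f).2, map_zero, neg_zero]
  · rw [hR.inner_apply_apply, ← inner_conj_symm, (h f).1, map_zero]

theorem symm (hR : IsQuatStructure R) (hΦ : ∀ f x, R (Φ f x) = Φ (sharp c f) (R x))
    (hc : ∀ z, (c z : ℂ) = conj (z : ℂ)) {u v : E} (h : CyclicOrtho Φ R u v) :
    CyclicOrtho Φ R v u := by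
  intro f
  have h0 := (h.starAlgHom_right hΦ hc f 1)
  rw [map_one, one_apply_eq_self] at h0
  exact ⟨by rw [← inner_conj_symm, h0.1, map_zero], by rw [hR.inner_apply_left, h0.2, neg_zero]⟩

end CyclicOrtho

theorem exists_maximal_upperVectors [CompactSpace s] (hR : IsQuatStructure R)
    (hΦ : ∀ f x, R (Φ f x) = Φ (sharp c f) (R x)) (hc : ∀ z, (c z : ℂ) = conj (z : ℂ)) :
    ∃ S : Set E, (∀ u ∈ S, u ≠ 0 ∧ IsUpperVector Φ R u) ∧ S.Pairwise (CyclicOrtho Φ R) ∧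
      ∀ y, (∀ u ∈ S, CyclicOrtho Φ R u y) → y = 0 := by
  obtain ⟨S, hS⟩ := zorn_subset
    {S : Set E | (∀ u ∈ S, u ≠ 0 ∧ IsUpperVector Φ R u) ∧ S.Pairwise (CyclicOrtho Φ R)} (by
      intro C hC hchain
      refine ⟨⋃₀ C, ⟨?_, ?_⟩, fun t ht => Set.subset_sUnion_of_mem ht⟩
      · rintro u ⟨t, ht, hu⟩
        exact (hC ht).1 u hu
      · exact (Set.pairwise_sUnion hchain.directedOn).2 fun t ht => (hC ht).2)
  refine ⟨S, hS.prop.1, hS.prop.2, fun y hy => ?_⟩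
  by_contra hne
  obtain ⟨v, hv0, hv, hvy⟩ := exists_isUpperVector hR hΦ hc hne
  have hort : ∀ u ∈ S, CyclicOrtho Φ R u v := by
    intro u hu
    rcases hvy with ⟨f, rfl⟩ | ⟨f, rfl⟩
    · exact (hy u hu).starAlgHom_right hΦ hc f
    · exact ((hy u hu).quat_right hR).starAlgHom_right hΦ hc f
  have hmem : v ∈ S := by
    refine hS.le_of_ge (y := insert v S) ⟨?_, ?_⟩ (Set.subset_insert _ _) (Set.mem_insert _ _)
    · rintro u (rfl | hu)
      exacts [⟨hv0, hv⟩, hS.prop.1 u hu]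
    · exact hS.prop.2.insert fun u hu _ => ⟨(hort u hu).symm hR hΦ hc, hort u hu⟩
  have := (hort v hmem 1).1
  rw [map_one, one_apply_eq_self] at this
  exact hv0 (inner_self_eq_zero.1 this)

end QuaternionicStructure

section QuaternionicDiagonal
open scoped InnerProductSpace ENNReal ComplexConjugate

variable {E : Type*} [NormedAddCommGroup E] [InnerProductSpace ℂ E]

theorem inner_eq_zero_of_mem_closure {T : E → E} (hT : Continuous T) {A B : Set E}
    (h : ∀ x ∈ A, ∀ y ∈ B, ⟪T x, y⟫_ℂ = 0) {x y : E} (hx : x ∈ closure A) (hy : y ∈ closure B) :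
    ⟪T x, y⟫_ℂ = 0 := by
  have h1 : ∀ x ∈ A, ∀ y ∈ closure B, ⟪T x, y⟫_ℂ = 0 := fun x hx =>
    closure_minimal (t := {y | ⟪T x, y⟫_ℂ = 0}) (h x hx)
      (isClosed_eq (by fun_prop) continuous_const)
  exact closure_minimal (t := {x | ⟪T x, y⟫_ℂ = 0}) (fun x hx => h1 x hx y hy)
    (isClosed_eq (by fun_prop) continuous_const) hx

theorem conj_mem_spectrum {R : E →L⋆[ℂ] E} (hR : IsQuatStructure R) [CompleteSpace E]
    {N : E →L[ℂ] E} (hRN : ∀ x, R (N x) = N (R x)) {z : ℂ} (hz : z ∈ spectrum ℂ N) :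
    conj z ∈ spectrum ℂ N := by
  rw [spectrum.mem_iff] at hz ⊢
  refine fun h => hz ?_
  have hb : Function.Bijective R := by
    refine ⟨fun x y hxy => ?_, fun y => ⟨-R y, by rw [map_neg, hR.apply_apply, neg_neg]⟩⟩
    simpa [hR.apply_apply] using congrArg R hxy
  have key : ∀ x, (algebraMap ℂ (E →L[ℂ] E) z - N) x
      = -R ((algebraMap ℂ (E →L[ℂ] E) (conj z) - N) (R x)) := by
    intro x
    simp only [sub_apply, Algebra.algebraMap_eq_smul_one, smul_apply, one_apply_eq_self, map_sub,
      map_smulₛₗ, Complex.conj_conj, hRN, hR.apply_apply, map_neg, smul_neg]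
    abel
  rw [ContinuousLinearMap.isUnit_iff_bijective] at h ⊢
  have : ⇑(algebraMap ℂ (E →L[ℂ] E) z - N)
      = Neg.neg ∘ R ∘ (algebraMap ℂ (E →L[ℂ] E) (conj z) - N) ∘ R := funext key
  rw [this]
  exact neg_involutive.bijective.comp (hb.comp (h.comp hb))

variable [CompleteSpace E]

theorem exists_quaternionic_diagonal_basis [TopologicalSpace.SeparableSpace E]
    (hfin : ¬ FiniteDimensional ℂ E) {R : E →L⋆[ℂ] E} (hR : IsQuatStructure R)
    {N : E →L[ℂ] E} (hN : IsStarNormal N) (hRN : ∀ x, R (N x) = N (R x))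
    {θ : ℂ → ℝ} (hθm : Measurable θ) (h0 : ∀ z, 0 ≤ θ z) (h1 : ∀ z, θ z < 1) {L : ℝ} (hL : 0 ≤ L)
    (hθ : ∀ z ∈ spectrum ℂ N, ∀ w ∈ spectrum ℂ N, 0 ≤ z.im → 0 ≤ w.im →
      ‖z - w‖ ≤ L * |θ z - θ w|) {ε : ℝ≥0∞} (hε : ε ≠ 0) :
    ∃ (e : ℕ → E) (d : ℕ → ℂ), Orthonormal ℂ e ∧ (∀ a b, ⟪R (e a), e b⟫_ℂ = 0) ∧
      (∀ y, (∀ r, ⟪e r, y⟫_ℂ = 0 ∧ ⟪R (e r), y⟫_ℂ = 0) → y = 0) ∧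
      ∑' r, ENNReal.ofReal (‖N (e r) - d r • e r‖ ^ 2) < ε := by
  have : CompactSpace (spectrum ℂ N) := isCompact_iff_compactSpace.1 (spectrum.isCompact N)
  let Φ : C(spectrum ℂ N, ℂ) →⋆ₐ[ℂ] (E →L[ℂ] E) := cfcHom hN
  have hid : Φ (coordFun _) = N := cfcHom_id hN
  let c : C(spectrum ℂ N, spectrum ℂ N) :=
    ⟨fun z => ⟨conj (z : ℂ), conj_mem_spectrum hR hRN z.2⟩, by fun_prop⟩
  have hc : ∀ z, (c z : ℂ) = conj (z : ℂ) := fun z => rfl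
  have hΦ : ∀ f x, R (Φ f x) = Φ (sharp c f) (R x) :=
    quat_starAlgHom hR (by rwa [hid]) hc
  obtain ⟨S, hS1, hS2, hS3⟩ := exists_maximal_upperVectors hR hΦ hc
  have hcount : S.Countable := by
    refine countable_of_pairwise_inner_eq_zero (fun u hu => (hS1 u hu).1) fun u hu v hv huv => ?_
    have := (hS2 hu hv huv 1).1
    rwa [map_one, one_apply_eq_self] at this
  have := hcount.to_subtype
  obtain ⟨δ, hδ, hδε⟩ := ENNReal.exists_pos_sum_of_countable' hε S
  choose w d η hw1 hw2 hw3 hw4 hw5 using fun u : S =>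
    exists_haar_block Φ (u : E) hθm h0 h1 hL hθ (hS1 u u.2).2.1 (hδ u).ne'
  have horth : ∀ a b : S × (ℕ × ℕ), a ≠ b → ⟪w a.1 a.2, w b.1 b.2⟫_ℂ = 0 := by
    rintro ⟨u, a⟩ ⟨v, b⟩ hab
    by_cases huv : u = v
    · subst huv
      exact hw1 u a b fun h => hab (by rw [h])
    · refine inner_eq_zero_of_mem_closure (T := id) continuous_id ?_ (hw2 u a) (hw2 v b)
      rintro _ ⟨f, rfl⟩ _ ⟨g, rfl⟩
      exact ((hS2 u.2 v.2 (Subtype.coe_injective.ne huv)).starAlgHom_right hΦ hc g f).1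
  have hRorth : ∀ a b : S × (ℕ × ℕ), ⟪R (w a.1 a.2), w b.1 b.2⟫_ℂ = 0 := by
    rintro ⟨u, a⟩ ⟨v, b⟩
    refine inner_eq_zero_of_mem_closure R.continuous ?_ (hw2 u a) (hw2 v b)
    rintro _ ⟨f, rfl⟩ _ ⟨g, rfl⟩
    by_cases huv : u = v
    · subst huv
      change ⟪R (Φ f u), Φ g u⟫_ℂ = 0
      rw [hΦ, inner_starAlgHom_left, starAlgHom_mul_apply]
      exact (hS1 u u.2).2.2 _
    · exact ((hS2 u.2 v.2 (Subtype.coe_injective.ne huv)).starAlgHom_right hΦ hc g f).2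
  have htotal : ∀ y, (∀ a : S × (ℕ × ℕ), ⟪w a.1 a.2, y⟫_ℂ = 0 ∧ ⟪R (w a.1 a.2), y⟫_ℂ = 0) →
      y = 0 := by
    have key : ∀ y, (∀ a : S × (ℕ × ℕ), ⟪w a.1 a.2, y⟫_ℂ = 0) → ∀ (u : S) f, ⟪Φ f u, y⟫_ℂ = 0 := by
      intro y hy u f
      refine closure_minimal (t := {x | ⟪x, y⟫_ℂ = 0}) (fun x hx => ?_)
        (isClosed_eq (by fun_prop) continuous_const) (hw3 u f)
      induction hx using Submodule.span_induction with
      | mem x hx => obtain ⟨a, rfl⟩ := hx; exact hy (u, a)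
      | zero => exact inner_zero_left _
      | add x x' _ _ hx hx' =>
        change ⟪x + x', y⟫_ℂ = 0
        rw [inner_add_left, hx, hx', add_zero]
      | smul r x _ hx =>
        change ⟪r • x, y⟫_ℂ = 0
        rw [inner_smul_left, hx, mul_zero]
    intro y hy
    refine hS3 y fun u hu f => ⟨key y (fun a => (hy a).1) ⟨u, hu⟩ f, ?_⟩
    rw [hR.inner_apply_left, ← inner_conj_symm,
      key (R y) (fun a => ?_) ⟨u, hu⟩ f, map_zero, neg_zero]
    rw [hR.inner_apply_right, ← inner_conj_symm, (hy a).2, map_zero, neg_zero]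
  let ι := {a : S × (ℕ × ℕ) // w a.1 a.2 ≠ 0}
  let e₀ : ι → E := fun a => ((‖w a.1.1 a.1.2‖⁻¹ : ℝ) : ℂ) • w a.1.1 a.1.2
  have he₀ : Orthonormal ℂ e₀ := by
    refine ⟨fun a => ?_, fun a b hab => ?_⟩
    · rw [norm_smul, Complex.norm_real, norm_inv, norm_norm,
        inv_mul_cancel₀ (norm_ne_zero_iff.2 a.2)]
    · change ⟪e₀ a, e₀ b⟫_ℂ = 0
      rw [inner_smul_left, inner_smul_right, horth a.1 b.1 (Subtype.coe_injective.ne hab)]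
      simp
  have hRe₀ : ∀ a b, ⟪R (e₀ a), e₀ b⟫_ℂ = 0 := by
    intro a b
    rw [map_smulₛₗ, inner_smul_left, inner_smul_right, hRorth a.1 b.1]
    simp
  have htot₀ : ∀ y, (∀ a, ⟪e₀ a, y⟫_ℂ = 0 ∧ ⟪R (e₀ a), y⟫_ℂ = 0) → y = 0 := by
    refine fun y hy => htotal y fun a => ?_
    by_cases ha : w a.1 a.2 = 0
    · simp [ha]
    · have hne : ((‖w a.1 a.2‖⁻¹ : ℝ) : ℂ) ≠ 0 := by
        exact_mod_cast inv_ne_zero (norm_ne_zero_iff.2 ha)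
      have h := hy ⟨a, ha⟩
      rw [map_smulₛₗ, inner_smul_left, inner_smul_left, mul_eq_zero, mul_eq_zero] at h
      exact ⟨h.1.resolve_left ((map_ne_zero _).2 hne),
        h.2.resolve_left ((map_ne_zero _).2 ((map_ne_zero _).2 hne))⟩
  have hinf : Infinite ι := by
    by_contra hnot
    have : Finite ι := not_infinite_iff_finite.1 hnot
    refine hfin ?_
    let W : Submodule ℂ E := Submodule.span ℂ (Set.range e₀ ∪ Set.range (R ∘ e₀))
    have : FiniteDimensional ℂ W :=
      FiniteDimensional.span_of_finite ℂ ((Set.finite_range _).union (Set.finite_range _))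
    have hW : W = ⊤ := by
      rw [← Submodule.orthogonal_eq_bot_iff, Submodule.eq_bot_iff]
      refine fun y hy => htot₀ y fun a => ⟨?_, ?_⟩
      · exact hy _ (Submodule.subset_span (Or.inl ⟨a, rfl⟩))
      · exact hy _ (Submodule.subset_span (Or.inr ⟨a, rfl⟩))
    rw [hW] at this
    exact Module.Finite.equiv (Submodule.topEquiv (R := ℂ) (M := E))
  obtain ⟨_⟩ := nonempty_denumerable ι
  let φ : ℕ ≃ ι := (Denumerable.eqv ι).symm
  refine ⟨e₀ ∘ φ, fun r => d (φ r).1.1 (φ r).1.2, he₀.comp _ φ.injective,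
    fun a b => hRe₀ _ _, fun y hy => htot₀ y fun a => ?_, ?_⟩
  · have := hy (φ.symm a)
    simpa using this
  · have hbound : ∀ a : ι, ‖N (e₀ a) - d a.1.1 a.1.2 • e₀ a‖ ^ 2 ≤ η a.1.1 a.1.2 ^ 2 := by
      intro a
      have hpos : 0 < ‖w a.1.1 a.1.2‖ := norm_pos_iff.2 a.2
      have h := hw4 a.1.1 a.1.2
      rw [hid] at h
      have : N (e₀ a) - d a.1.1 a.1.2 • e₀ a = ((‖w a.1.1 a.1.2‖⁻¹ : ℝ) : ℂ) •
          (N (w a.1.1 a.1.2) - d a.1.1 a.1.2 • w a.1.1 a.1.2) := by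
        rw [map_smul, smul_comm, smul_sub]
      refine pow_le_pow_left₀ (norm_nonneg _) ?_ 2
      rw [this, norm_smul, Complex.norm_real, norm_inv, norm_norm, inv_mul_le_iff₀ hpos, mul_comm]
      exact h
    calc _ ≤ ∑' r, ENNReal.ofReal (η (φ r).1.1 (φ r).1.2 ^ 2) :=
          ENNReal.tsum_le_tsum fun r => ENNReal.ofReal_le_ofReal (hbound (φ r))
      _ = ∑' a : ι, ENNReal.ofReal (η a.1.1 a.1.2 ^ 2) :=
          φ.tsum_eq fun a : ι => ENNReal.ofReal (η a.1.1 a.1.2 ^ 2)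
      _ ≤ ∑' a : S × (ℕ × ℕ), ENNReal.ofReal (η a.1 a.2 ^ 2) :=
          ENNReal.tsum_comp_le_tsum_of_injective Subtype.coe_injective
            (fun a : S × (ℕ × ℕ) => ENNReal.ofReal (η a.1 a.2 ^ 2))
      _ = ∑' u : S, ∑' a, ENNReal.ofReal (η u a ^ 2) :=
          ENNReal.tsum_prod (f := fun (u : S) a => ENNReal.ofReal (η u a ^ 2))
      _ ≤ ∑' u, δ u := ENNReal.tsum_le_tsum hw5
      _ < ε := hδε

end QuaternionicDiagonal

section ArcLength
open Set

variable {F : Type*} [PseudoMetricSpace F]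

theorem dist_le_abs_variationOnFromTo {γ : ℝ → F} {I : Set ℝ} (hγ : LocallyBoundedVariationOn γ I)
    {o s t : ℝ} (ho : o ∈ I) (hs : s ∈ I) (ht : t ∈ I) :
    dist (γ s) (γ t) ≤ |variationOnFromTo γ I o s - variationOnFromTo γ I o t| := by
  wlog hst : s ≤ t generalizing s t
  · rw [dist_comm, abs_sub_comm]
    exact this ht hs (le_of_not_ge hst)
  have h := variationOnFromTo.add hγ ho hs ht
  rw [abs_sub_comm, ← h, add_sub_cancel_left, variationOnFromTo.eq_of_le _ _ hst]
  refine le_trans ?_ (le_abs_self _)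
  rw [dist_edist]
  exact ENNReal.toReal_mono (hγ s t hs ht)
    (eVariationOn.edist_le γ ⟨hs, le_rfl, hst⟩ ⟨ht, hst, le_rfl⟩)

theorem exists_measurable_section_coordinate {q : ℂ → F} (hq : Continuous q) [T2Space F]
    {γ : ℝ → F} (hγ : ContinuousOn γ (Icc 0 1)) :
    ∃ τ : ℂ → ℝ, Measurable τ ∧ ∀ z, q z ∈ γ '' Icc 0 1 → τ z ∈ Icc (0 : ℝ) 1 ∧ γ (τ z) = q z := by
  let A : ℂ → Set ℝ := fun z => {t | t ∈ Icc (0 : ℝ) 1 ∧ γ t = q z}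
  have hAbdd : ∀ z, BddBelow (A z) := fun z => ⟨0, fun t ht => ht.1.1⟩
  have hmem : ∀ z, (A z).Nonempty → sInf (A z) ∈ A z := fun z hz =>
    (hγ.preimage_isClosed_of_isClosed isClosed_Icc isClosed_singleton).csInf_mem hz (hAbdd z)
  have hne : ∀ z, q z ∈ γ '' Icc 0 1 → (A z).Nonempty := fun z ⟨t, ht, hz⟩ => ⟨t, ht, hz⟩
  refine ⟨fun z => sInf (A z), measurable_of_Iic fun s => ?_, fun z hz => hmem z (hne z hz)⟩
  have hmeas : ∀ s, MeasurableSet (q ⁻¹' (γ '' (Icc 0 1 ∩ Iic s))) := fun s =>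
    (((isCompact_Icc.inter_right isClosed_Iic).image_of_continuousOn
      (hγ.mono inter_subset_left)).isClosed.preimage hq).measurableSet
  rcases lt_or_ge s 0 with hs | hs
  · convert MeasurableSet.empty
    ext z
    simp only [mem_preimage, mem_Iic, mem_empty_iff_false, iff_false, not_le]
    exact hs.trans_le (Real.sInf_nonneg fun t ht => ht.1.1)
  · convert (hmeas s).union (hmeas 1).compl
    ext z
    simp only [mem_preimage, mem_Iic, mem_union, mem_compl_iff]
    constructor
    · intro h
      by_cases hz : (A z).Nonempty
      · exact Or.inl ⟨_, ⟨(hmem z hz).1, h⟩, (hmem z hz).2⟩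
      · exact Or.inr fun ⟨t, ht, hz'⟩ => hz ⟨t, ht.1, hz'⟩
    · rintro (⟨t, ⟨ht, hts⟩, hz⟩ | hz)
      · exact (csInf_le (hAbdd z) ⟨ht, hz⟩).trans hts
      · have : A z = ∅ := by
          rw [← not_nonempty_iff_eq_empty]
          exact fun ⟨t, ht, hz'⟩ => hz ⟨t, ⟨ht, ht.2⟩, hz'⟩
        rw [this, Real.sInf_empty]
        exact hs

theorem exists_arclength_coordinate {q : ℂ → F} (hq : Isometry q) [T2Space F]
    {γ : ℝ → F} (hγ : ContinuousOn γ (Icc 0 1)) (hv : BoundedVariationOn γ (Icc 0 1)) :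
    ∃ (θ : ℂ → ℝ) (L : ℝ), Measurable θ ∧ (∀ z, 0 ≤ θ z) ∧ (∀ z, θ z < 1) ∧ 0 ≤ L ∧
      ∀ z w, q z ∈ γ '' Icc 0 1 → q w ∈ γ '' Icc 0 1 → ‖z - w‖ ≤ L * |θ z - θ w| := by
  obtain ⟨τ, hτm, hτ⟩ := exists_measurable_section_coordinate hq.continuous hγ
  have hlv := hv.locallyBoundedVariationOn
  have h0 : (0 : ℝ) ∈ Icc (0 : ℝ) 1 := ⟨le_rfl, zero_le_one⟩
  have h1 : (1 : ℝ) ∈ Icc (0 : ℝ) 1 := ⟨zero_le_one, le_rfl⟩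
  have hmono := variationOnFromTo.monotoneOn hlv h0
  let ℓ : ℝ → ℝ := IccExtend (zero_le_one' ℝ)
    fun t : Icc (0 : ℝ) 1 => variationOnFromTo γ (Icc 0 1) 0 t
  have hℓ : Monotone ℓ := Monotone.IccExtend _ fun s t hst => hmono s.2 t.2 hst
  have hℓ0 : ∀ t, 0 ≤ ℓ t := fun t => variationOnFromTo.nonneg_of_le _ _ (projIcc 0 1 _ t).2.1
  set T := variationOnFromTo γ (Icc 0 1) 0 1 with hT
  have hℓ1 : ∀ t, ℓ t ≤ T := fun t =>
    hmono (projIcc 0 1 zero_le_one t).2 h1 (projIcc 0 1 zero_le_one t).2.2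
  have hT0 : 0 ≤ T := variationOnFromTo.nonneg_of_le _ _ zero_le_one
  have hT1 : 0 < T + 1 := by linarith
  refine ⟨fun z => ℓ (τ z) / (T + 1), T + 1, (hℓ.measurable.comp hτm).div_const _,
    fun z => div_nonneg (hℓ0 _) hT1.le, fun z => ?_, hT1.le, fun z w hz hw => ?_⟩
  · rw [div_lt_one hT1]
    linarith [hℓ1 (τ z)]
  · rw [← sub_div, abs_div, abs_of_pos hT1, mul_div_cancel₀ _ hT1.ne', ← dist_eq_norm,
      ← hq.dist_eq, ← (hτ z hz).2, ← (hτ w hw).2]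
    simp only [ℓ]
    rw [IccExtend_of_mem _ _ (hτ z hz).1, IccExtend_of_mem _ _ (hτ w hw).1]
    exact dist_le_abs_variationOnFromTo hlv h0 (hτ z hz).1 (hτ w hw).1

end ArcLength

section DiagonalSplitting
open scoped InnerProductSpace ComplexConjugate

variable {E : Type*} [NormedAddCommGroup E] [InnerProductSpace ℂ E]

theorem exists_clm_hasSum_inner_smul [CompleteSpace E] {e s : ℕ → E} (he : Orthonormal ℂ e)
    (hs : Summable fun r => ‖s r‖ ^ 2) :
    ∃ T : E →L[ℂ] E, ∀ x, HasSum (fun r => ⟪e r, x⟫_ℂ • s r) (T x) := by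
  have hbound : ∀ x, Summable (fun r => ‖⟪e r, x⟫_ℂ‖ * ‖s r‖) ∧
      ∑' r, ‖⟪e r, x⟫_ℂ‖ * ‖s r‖ ≤ ‖x‖ * √(∑' r, ‖s r‖ ^ 2) := by
    intro x
    have hx := he.inner_products_summable x
    have h := Real.summable_and_inner_le_Lp_mul_Lq_tsum_of_nonneg
      (Real.HolderConjugate.two_two) (f := fun r => ‖⟪e r, x⟫_ℂ‖) (g := fun r => ‖s r‖)
      (fun _ => norm_nonneg _) (fun _ => norm_nonneg _) (by simpa using hx) (by simpa using hs)
    refine ⟨h.1, h.2.trans ?_⟩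
    simp only [Real.rpow_two, ← Real.sqrt_eq_rpow]
    gcongr
    rw [Real.sqrt_le_left (norm_nonneg _)]
    exact he.tsum_inner_products_le x
  have hsum : ∀ x, Summable fun r => ⟪e r, x⟫_ℂ • s r := fun x =>
    Summable.of_norm (by simpa only [norm_smul] using (hbound x).1)
  let T : E →ₗ[ℂ] E :=
    { toFun := fun x => ∑' r, ⟪e r, x⟫_ℂ • s r
      map_add' := fun x y => by
        simp only [inner_add_right, add_smul]
        exact (hsum x).tsum_add (hsum y)
      map_smul' := fun a x => by
        simp only [inner_smul_right, mul_smul, RingHom.id_apply]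
        exact (hsum x).tsum_const_smul a }
  refine ⟨T.mkContinuous (√(∑' r, ‖s r‖ ^ 2)) fun x => ?_, fun x => (hsum x).hasSum⟩
  rw [mul_comm]
  refine le_trans (norm_tsum_le_tsum_norm ?_) ?_
  · simpa only [norm_smul] using (hbound x).1
  · simpa only [norm_smul] using (hbound x).2

variable {R : E →L⋆[ℂ] E} {e : ℕ → E}

theorem IsQuatStructure.orthonormal_comp (hR : IsQuatStructure R) (he : Orthonormal ℂ e) :
    Orthonormal ℂ fun r => R (e r) :=
  ⟨fun r => by rw [hR.norm_apply, he.1 r], fun r t hrt => by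
    change ⟪R (e r), R (e t)⟫_ℂ = 0
    rw [hR.inner_apply_apply, he.2 hrt.symm]⟩

theorem hasSum_quaternionic_expansion [CompleteSpace E] (hR : IsQuatStructure R)
    (he : Orthonormal ℂ e) (hRe : ∀ a b, ⟪R (e a), e b⟫_ℂ = 0)
    (htot : ∀ y, (∀ r, ⟪e r, y⟫_ℂ = 0 ∧ ⟪R (e r), y⟫_ℂ = 0) → y = 0) (x : E) :
    HasSum (fun r => ⟪e r, x⟫_ℂ • e r + ⟪R (e r), x⟫_ℂ • R (e r)) x := by
  have horth : Orthonormal ℂ (Sum.elim e fun r => R (e r)) := by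
    refine ⟨?_, ?_⟩
    · rintro (r | r)
      exacts [he.1 r, (hR.orthonormal_comp he).1 r]
    · rintro (r | r) (t | t) hrt
      · exact he.2 fun h => hrt (by rw [h])
      · change ⟪e r, R (e t)⟫_ℂ = 0
        rw [← inner_conj_symm, hRe, map_zero]
      · exact hRe r t
      · exact (hR.orthonormal_comp he).2 fun h => hrt (by rw [h])
  obtain ⟨b, hb⟩ : ∃ b : HilbertBasis (ℕ ⊕ ℕ) ℂ E, ⇑b = Sum.elim e fun r => R (e r) := by
    refine ⟨HilbertBasis.mkOfOrthogonalEqBot horth ?_, HilbertBasis.coe_mkOfOrthogonalEqBot _ _⟩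
    rw [Submodule.eq_bot_iff]
    exact fun y hy => htot y fun r => ⟨hy _ (Submodule.subset_span ⟨Sum.inl r, rfl⟩),
      hy _ (Submodule.subset_span ⟨Sum.inr r, rfl⟩)⟩
  set f : ℕ → E := fun r => ⟪e r, x⟫_ℂ • e r
  set g : ℕ → E := fun r => ⟪R (e r), x⟫_ℂ • R (e r)
  have h : HasSum (Sum.elim f g) x := by
    refine (b.hasSum_repr x).congr_fun ?_
    rintro (r | r) <;> simp only [b.repr_apply_apply, hb, Sum.elim_inl, Sum.elim_inr, f, g]
  have hf : Summable f := by
    rw [← Sum.elim_comp_inl f g]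
    exact h.summable.comp_injective Sum.inl_injective
  have hg : Summable g := by
    rw [← Sum.elim_comp_inr f g]
    exact h.summable.comp_injective Sum.inr_injective
  have hx : x = ∑' r, f r + ∑' r, g r := h.unique (hf.hasSum.sum (f := Sum.elim f g) hg.hasSum)
  have h3 := hf.hasSum.add hg.hasSum
  rw [← hx] at h3
  exact h3

theorem exists_diagonal_add_clm [CompleteSpace E] (hR : IsQuatStructure R) {N : E →L[ℂ] E}
    (hRN : ∀ x, R (N x) = N (R x)) (he : Orthonormal ℂ e) (hRe : ∀ a b, ⟪R (e a), e b⟫_ℂ = 0)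
    {d : ℕ → ℂ} (hs : Summable fun r => ‖N (e r) - d r • e r‖ ^ 2) :
    ∃ D S : E →L[ℂ] E, (∀ x, R (D x) = D (R x)) ∧ (∀ x, R (S x) = S (R x)) ∧ N = D + S ∧
      (∀ r, D (e r) = d r • e r) ∧ ∀ r, S (e r) = N (e r) - d r • e r := by
  obtain ⟨T₁, hT₁⟩ := exists_clm_hasSum_inner_smul he hs
  obtain ⟨T₂, hT₂⟩ := exists_clm_hasSum_inner_smul (s := fun r => R (N (e r) - d r • e r))
    (hR.orthonormal_comp he) (by simpa only [hR.norm_apply] using hs)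
  have hRT : ∀ x, R (T₁ x) = T₂ (R x) := by
    intro x
    refine ((hT₁ x).map R R.continuous).unique ?_
    convert hT₂ (R x) using 2 with r
    rw [Function.comp_apply, map_smulₛₗ, hR.inner_apply_apply, inner_conj_symm]
  have hRT' : ∀ x, R (T₂ x) = T₁ (R x) := by
    intro x
    have h := hRT (R x)
    rw [hR.apply_apply, map_neg] at h
    rw [← neg_neg (T₂ x), ← h, map_neg, hR.apply_apply, neg_neg]
  have hSe : ∀ r, (T₁ + T₂) (e r) = N (e r) - d r • e r := by
    intro r
    have h1 : T₁ (e r) = N (e r) - d r • e r := by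
      refine (hT₁ (e r)).unique ?_
      convert hasSum_ite_eq r (N (e r) - d r • e r) using 2 with t
      rw [orthonormal_iff_ite.1 he]
      split_ifs with h
      · rw [h, one_smul]
      · rw [zero_smul]
    have h2 : T₂ (e r) = 0 := by
      refine (hT₂ (e r)).unique ?_
      simp only [hRe, zero_smul]
      exact hasSum_zero
    rw [add_apply, h1, h2, add_zero]
  have hRS : ∀ x, R ((T₁ + T₂) x) = (T₁ + T₂) (R x) := by
    intro x
    rw [add_apply, add_apply, map_add, hRT, hRT', add_comm]
  refine ⟨N - (T₁ + T₂), T₁ + T₂, fun x => ?_, hRS, by simp, fun r => ?_, hSe⟩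
  · rw [sub_apply, sub_apply, map_sub, hRN, hRS]
  · rw [sub_apply, hSe, sub_sub_cancel]

end DiagonalSplitting

section SliceStructure
open scoped InnerProductSpace ComplexConjugate

theorem norm_coeComplex (c : ℂ) : ‖(c : Hq)‖ = ‖c‖ := by
  rw [← sq_eq_sq₀ (norm_nonneg _) (norm_nonneg _), sq, ← Quaternion.normSq_eq_norm_mul_self,
    Quaternion.normSq_def', ← Complex.normSq_eq_norm_sq, Complex.normSq_apply]
  simp
  ring

/-- The complex inner product structure on `ℍ` given by right multiplication by `ℂ ⊆ ℍ`; the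
inner product is the `ℂ`-component of `star q * p`. -/
abbrev quaternionInnerProductSpace : InnerProductSpace ℂ Hq where
  smul c q := q * (c : Hq)
  one_smul q := by
    change q * ((1 : ℂ) : Hq) = q
    simp
  mul_smul a b q := by
    change q * ((a * b : ℂ) : Hq) = q * (b : Hq) * (a : Hq)
    rw [mul_comm a b, Quaternion.coeComplex_mul, mul_assoc]
  smul_zero a := zero_mul _
  smul_add a p q := add_mul _ _ _
  add_smul a b q := by
    change q * ((a + b : ℂ) : Hq) = q * (a : Hq) + q * (b : Hq)
    rw [Quaternion.coeComplex_add, mul_add]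
  zero_smul q := by
    change q * ((0 : ℂ) : Hq) = 0
    simp
  norm_smul_le c q := by
    change ‖q * (c : Hq)‖ ≤ _
    rw [norm_mul, norm_coeComplex, mul_comm]
  inner q p := ⟨(star q * p).re, (star q * p).imI⟩
  norm_sq_eq_re_inner q := by
    change ‖q‖ ^ 2 = (star q * q).re
    rw [Quaternion.star_mul_self, Quaternion.re_coe, Quaternion.normSq_eq_norm_mul_self, sq]
  conj_inner_symm q p := by
    apply Complex.ext <;> simp <;> ring
  add_left p q r := by
    apply Complex.ext <;> simp <;> ring
  smul_left q p c := by
    change (⟨(star (q * (c : Hq)) * p).re, (star (q * (c : Hq)) * p).imI⟩ : ℂ) = _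
    apply Complex.ext <;> simp <;> ring

attribute [local instance] quaternionInnerProductSpace

theorem quaternion_inner_eq (q p : Hq) :
    ⟪q, p⟫_ℂ = ⟨(star q * p).re, (star q * p).imI⟩ := rfl

/-- The quaternion unit `j`. -/
def quatJ : Hq := ⟨0, 0, 1, 0⟩

@[simp] theorem re_quatJ : quatJ.re = 0 := rfl

@[simp] theorem imI_quatJ : quatJ.imI = 0 := rfl

@[simp] theorem imJ_quatJ : quatJ.imJ = 1 := rfl

@[simp] theorem imK_quatJ : quatJ.imK = 0 := rfl

theorem star_mul_eq_inner (q p : Hq) :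
    star q * p = (⟪q, p⟫_ℂ : Hq) + quatJ * (⟪q * quatJ, p⟫_ℂ : Hq) := by
  simp only [quaternion_inner_eq]
  ext <;> simp <;> ring

theorem exists_eq_coeComplex_add (q : Hq) : ∃ a b : ℂ, q = (a : Hq) + quatJ * (b : Hq) := by
  refine ⟨⟨q.re, q.imI⟩, ⟨q.imJ, -q.imK⟩, ?_⟩
  ext <;> simp

theorem rsmul_coeComplex (c : ℂ) (x : Hsp) : rsmul (c : Hq) x = c • x := rfl

theorem rsmul_add_right (q : Hq) (x y : Hsp) : rsmul q (x + y) = rsmul q x + rsmul q y :=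
  smul_add _ _ _

theorem rsmul_add_left (p q : Hq) (x : Hsp) : rsmul (p + q) x = rsmul p x + rsmul q x :=
  add_smul _ _ _

theorem rsmul_mul (p q : Hq) (x : Hsp) : rsmul (p * q) x = rsmul q (rsmul p x) :=
  mul_smul (MulOpposite.op q) (MulOpposite.op p) x

theorem norm_quatJ : ‖quatJ‖ = 1 := by
  rw [← sq_eq_sq₀ (norm_nonneg _) zero_le_one, sq, ← Quaternion.normSq_eq_norm_mul_self,
    Quaternion.normSq_def']
  simp

theorem coeComplex_mul_quatJ (c : ℂ) : (c : Hq) * quatJ = quatJ * ((conj c : ℂ) : Hq) := by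
  ext <;> simp

/-- Right multiplication by `j` as a conjugate-linear operator on `ℓ²(ℕ, ℍ)`. -/
def rightJ : Hsp →L⋆[ℂ] Hsp :=
  LinearMap.mkContinuous
    { toFun := rsmul quatJ
      map_add' := rsmul_add_right _
      map_smul' := fun c x => by
        change rsmul quatJ (rsmul (c : Hq) x) = rsmul ((conj c : ℂ) : Hq) (rsmul quatJ x)
        rw [← rsmul_mul, ← rsmul_mul, coeComplex_mul_quatJ] } 1 fun x => by
    change ‖MulOpposite.op quatJ • x‖ ≤ _
    refine (norm_smul_le _ _).trans ?_
    rw [MulOpposite.norm_op, norm_quatJ]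

theorem isQuatStructure_rightJ : IsQuatStructure rightJ where
  apply_apply x := by
    ext1; funext n
    change x n * quatJ * quatJ = - x n
    rw [mul_assoc, show quatJ * quatJ = -1 by ext <;> simp, mul_neg_one]
  inner_apply_apply x y := by
    rw [lp.inner_eq_tsum, lp.inner_eq_tsum]
    congr 1 with n
    change ⟪x n * quatJ, y n * quatJ⟫_ℂ = _
    simp only [quaternion_inner_eq]
    apply Complex.ext <;> simp <;> ring

theorem rsmul_eq_smul_add (a b : ℂ) (x : Hsp) :
    rsmul ((a : Hq) + quatJ * (b : Hq)) x = a • x + b • rightJ x := by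
  rw [rsmul_add_left, rsmul_mul]
  rfl

theorem qinner_eq_inner (x y : Hsp) :
    qinner x y = (⟪x, y⟫_ℂ : Hq) + quatJ * (⟪rightJ x, y⟫_ℂ : Hq) := by
  have hc : Continuous Quaternion.ofComplex :=
    Quaternion.ofComplex.toLinearMap.continuous_of_finiteDimensional
  have h1 := (lp.hasSum_inner (𝕜 := ℂ) x y).map Quaternion.ofComplex hc
  have h2 := ((lp.hasSum_inner (𝕜 := ℂ) (rightJ x) y).map Quaternion.ofComplex hc).mul_left quatJ
  refine ((h1.add h2).congr_fun fun n => ?_).tsum_eq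
  exact star_mul_eq_inner _ _

theorem coeComplex_add_quatJ_mul_injective {a b c d : ℂ}
    (h : (a : Hq) + quatJ * (b : Hq) = (c : Hq) + quatJ * (d : Hq)) : a = c ∧ b = d := by
  have h1 := congrArg QuaternionAlgebra.re h
  have h2 := congrArg QuaternionAlgebra.imI h
  have h3 := congrArg QuaternionAlgebra.imJ h
  have h4 := congrArg QuaternionAlgebra.imK h
  simp at h1 h2 h3 h4
  exact ⟨Complex.ext h1 h2, Complex.ext h3 h4⟩

theorem IsBoundedRightLinear.exists_clm {T : Hsp → Hsp} (hT : IsBoundedRightLinear T) :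
    ∃ T' : Hsp →L[ℂ] Hsp, (∀ x, T' x = T x) ∧ ∀ x, rightJ (T' x) = T' (rightJ x) := by
  obtain ⟨hadd, hsmul, M, hM⟩ := hT
  exact ⟨LinearMap.mkContinuous
    { toFun := T, map_add' := hadd, map_smul' := fun c x => hsmul (c : Hq) x } M hM,
    fun _ => rfl, fun x => (hsmul quatJ x).symm⟩

theorem isBoundedRightLinear_coe {T : Hsp →L[ℂ] Hsp} (hT : ∀ x, rightJ (T x) = T (rightJ x)) :
    IsBoundedRightLinear T := by
  refine ⟨map_add T, fun q x => ?_, ‖T‖, T.le_opNorm⟩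
  obtain ⟨a, b, rfl⟩ := exists_eq_coeComplex_add q
  rw [rsmul_eq_smul_add, rsmul_eq_smul_add, map_add, map_smul, map_smul, hT]

theorem isStarNormal_of_adjointOf {T : Hsp →L[ℂ] Hsp} {S : Hsp → Hsp} (h : AdjointOf T S)
    (hS : ∀ x, S (T x) = T (S x)) : IsStarNormal T := by
  have hstar : ∀ y, star T y = S y := by
    intro y
    refine ext_inner_right ℂ fun x => ?_
    have hx := h x y
    rw [qinner_eq_inner, qinner_eq_inner] at hx
    rw [ContinuousLinearMap.star_eq_adjoint, ContinuousLinearMap.adjoint_inner_left]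
    exact (coeComplex_add_quatJ_mul_injective hx).1
  refine ⟨ContinuousLinearMap.ext fun x => ?_⟩
  rw [mul_apply_eq_comp, mul_apply_eq_comp, hstar, hstar, hS]

theorem sphDeltaB_coe_apply (T : Hsp →L[ℂ] Hsp) (z : ℂ) (x : Hsp) :
    sphDeltaB T (z : Hq) x =
      ((T - algebraMap ℂ _ z) * (T - algebraMap ℂ _ (conj z))) x := by
  have h1 : (z : Hq) + star (z : Hq) = ((z + conj z : ℂ) : Hq) := by ext <;> simp
  have h2 : ((normSq (z : Hq) : ℝ) : Hq) = ((z * conj z : ℂ) : Hq) := by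
    rw [Complex.mul_conj, Quaternion.coeComplex_coe, Quaternion.normSq_def',
      Complex.normSq_apply]
    congr 1
    simp
    ring
  rw [sphDeltaB, h1, h2, rsmul_coeComplex, rsmul_coeComplex]
  simp only [mul_apply_eq_comp, sub_apply, Algebra.algebraMap_eq_smul_one, smul_apply,
    one_apply_eq_self, map_sub, map_smul]
  module

theorem coeComplex_mem_sphSpectrumB {T : Hsp →L[ℂ] Hsp} {z : ℂ} (hz : z ∈ spectrum ℂ T) :
    (z : Hq) ∈ sphSpectrumB T := by
  rintro ⟨-, hdense, M, hM⟩
  set A := T - algebraMap ℂ (Hsp →L[ℂ] Hsp) z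
  set B := T - algebraMap ℂ (Hsp →L[ℂ] Hsp) (conj z)
  have hΔ : sphDeltaB T (z : Hq) = (A * B : Hsp →L[ℂ] Hsp) := funext (sphDeltaB_coe_apply T z)
  rw [hΔ] at hdense hM
  have hanti : AntilipschitzWith M.toNNReal (A * B) :=
    (A * B).antilipschitz_of_bound fun x => (hM x).trans
      (mul_le_mul_of_nonneg_right (Real.le_coe_toNNReal M) (norm_nonneg _))
  have hunit : IsUnit (A * B) := by
    rw [ContinuousLinearMap.isUnit_iff_bijective]
    refine ⟨hanti.injective, fun y => ?_⟩
    have hcl := (hanti.isClosed_range (A * B).uniformContinuous).closure_eq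
    rw [hdense.closure_eq] at hcl
    exact (Set.ext_iff.1 hcl y).1 (Set.mem_univ y)
  have hcomm : Commute A B :=
    ((Commute.refl T).sub_right (Algebra.commute_algebraMap_right _ _)).sub_left
      (Algebra.commute_algebraMap_left _ _)
  refine hz ?_
  rw [spectrum.mem_resolventSet_iff, ← neg_sub, IsUnit.neg_iff]
  exact (hcomm.isUnit_mul_iff.1 hunit).1

theorem re_coe_add_mul_coe {m : Hq} (hm : m ∈ QS) (a b : ℝ) :
    ((a : Hq) + m * (b : Hq)).re = a := by
  have h : m.re = 0 := by
    have h := congrArg QuaternionAlgebra.re hm.1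
    simp at h
    linarith
  simp [h]

theorem normSq_coe_add_mul_coe {m : Hq} (hm : m ∈ QS) (a b : ℝ) :
    normSq ((a : Hq) + m * (b : Hq)) = a ^ 2 + b ^ 2 := by
  have h : m.re = 0 := by simpa using re_coe_add_mul_coe hm 0 1
  have h1 : normSq m = 1 := by rw [Quaternion.normSq_eq_norm_mul_self, hm.2, one_mul]
  rw [Quaternion.normSq_def'] at h1 ⊢
  simp [h] at h1 ⊢
  linear_combination b ^ 2 * h1

theorem coe_add_mul_coe_mem_of_mem_circ {m : Hq} (hm : m ∈ QS) {K : Set Hq}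
    (hK : K ⊆ sliceCplus m) {z : ℂ} (hz : (z : Hq) ∈ circ m K) (hz0 : 0 ≤ z.im) :
    (z.re : Hq) + m * (z.im : Hq) ∈ K := by
  obtain ⟨α, β, j, hj, hmem, hzj⟩ := hz
  obtain ⟨α', β', hβ', heq⟩ := hK hmem
  have h1 : z.re = α := by
    rw [← re_coe_add_mul_coe hj α β, ← hzj, Quaternion.re_coeComplex]
  have h2 : z.re ^ 2 + z.im ^ 2 = α ^ 2 + β ^ 2 := by
    rw [← normSq_coe_add_mul_coe hj α β, ← hzj, Quaternion.normSq_def']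
    simp
  have h3 : α = α' := by
    rw [← re_coe_add_mul_coe hm α β, heq, re_coe_add_mul_coe hm]
  have h4 : α ^ 2 + β ^ 2 = α' ^ 2 + β' ^ 2 := by
    rw [← normSq_coe_add_mul_coe hm α β, heq, normSq_coe_add_mul_coe hm]
  have h5 : z.im = β' := by
    rw [← sq_eq_sq₀ hz0 hβ']
    subst h1 h3
    linarith
  rw [heq, ← h3, ← h1, ← h5] at hmem
  exact hmem

theorem isometry_slice {m : Hq} (hm : m ∈ QS) :
    Isometry fun z : ℂ => (z.re : Hq) + m * (z.im : Hq) := by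
  refine Isometry.of_dist_eq fun z w => ?_
  rw [dist_eq_norm, dist_eq_norm, ← sq_eq_sq₀ (norm_nonneg _) (norm_nonneg _), sq,
    ← Quaternion.normSq_eq_norm_mul_self, ← Complex.normSq_eq_norm_sq, Complex.normSq_apply,
    Complex.sub_re, Complex.sub_im, ← sq, ← sq, ← normSq_coe_add_mul_coe hm]
  congr 1
  push_cast
  noncomm_ring

theorem separableSpace_Hsp : TopologicalSpace.SeparableSpace Hsp := by
  have hS : TopologicalSpace.IsSeparable (⋃ n, Set.range fun q : Hq => (lp.single 2 n q : Hsp)) :=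
    TopologicalSpace.IsSeparable.iUnion fun n => TopologicalSpace.isSeparable_range
      (lp.isometry_single (E := fun _ : ℕ => Hq) (p := 2) n).continuous
  have h := (hS.span (R := ℂ)).closure
  rw [← TopologicalSpace.isSeparable_univ_iff]
  refine h.mono fun x _ => ?_
  refine mem_closure_of_tendsto (lp.hasSum_single (by simp) x) (Eventually.of_forall fun s => ?_)
  exact Submodule.sum_mem _ fun n _ =>
    Submodule.subset_span (Set.mem_iUnion.2 ⟨n, Set.mem_range_self _⟩)

theorem not_finiteDimensional_Hsp : ¬ FiniteDimensional ℂ Hsp := by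
  intro h
  have horth : Orthonormal ℂ fun n : ℕ => (lp.single 2 n (1 : Hq) : Hsp) := by
    refine ⟨fun n => by simp [lp.norm_single], fun n k hnk => ?_⟩
    change ⟪(lp.single 2 n (1 : Hq) : Hsp), (lp.single 2 k (1 : Hq) : Hsp)⟫_ℂ = 0
    rw [lp.inner_single_left, lp.single_apply_ne _ _ _ hnk, inner_zero_right]
  exact not_finite_iff_infinite.2 inferInstance horth.linearIndependent.finite

theorem isONBasisOn_univ {e : ℕ → Hsp} (he : Orthonormal ℂ e)
    (hRe : ∀ a b, ⟪rightJ (e a), e b⟫_ℂ = 0)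
    (htot : ∀ y, (∀ r, ⟪e r, y⟫_ℂ = 0 ∧ ⟪rightJ (e r), y⟫_ℂ = 0) → y = 0) :
    IsONBasisOn Set.univ e := by
  refine ⟨fun _ => Set.mem_univ _, fun r t => ?_, fun x _ => ?_⟩
  · rw [qinner_eq_inner, hRe, orthonormal_iff_ite.1 he]
    split_ifs <;> simp
  · convert hasSum_quaternionic_expansion isQuatStructure_rightJ he hRe htot x using 2 with r
    rw [qinner_eq_inner, rsmul_eq_smul_add]

theorem exists_diagonal_add_hilbertSchmidt {m : Hq} (hm : m ∈ QS) {N : Hsp →L[ℂ] Hsp}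
    (hRN : ∀ x, rightJ (N x) = N (rightJ x)) (hN : IsStarNormal N) {K : Set Hq}
    (hK : K ⊆ sliceCplus m) {γ : ℝ → Hq} (hγ : ContinuousOn γ (Set.Icc 0 1))
    (hγv : BoundedVariationOn γ (Set.Icc 0 1)) (hKγ : K ⊆ γ '' Set.Icc 0 1)
    (hspec : sphSpectrumB N ⊆ circ m K) {ε : ℝ} (hε : 0 < ε) :
    ∃ D S : Hsp → Hsp, IsBoundedRightLinear D ∧ IsBoundedRightLinear S ∧
      (∃ e : ℕ → Hsp, IsONBasisOn Set.univ e ∧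
        ∃ q : ℕ → Hq, ∀ r, D (e r) = rsmul (q r) (e r)) ∧
      (∃ v : ℝ, HasHSNormSqOn S Set.univ v ∧ Real.sqrt v < ε) ∧
      (∀ x, N x = D x + S x) := by
  have := separableSpace_Hsp
  obtain ⟨θ, L, hθm, h0, h1, hL, hθ⟩ := exists_arclength_coordinate (isometry_slice hm) hγ hγv
  have hmem : ∀ z ∈ spectrum ℂ N, 0 ≤ z.im →
      (z.re : Hq) + m * (z.im : Hq) ∈ γ '' Set.Icc 0 1 := fun z hz hz0 =>
    hKγ (coe_add_mul_coe_mem_of_mem_circ hm hK (hspec (coeComplex_mem_sphSpectrumB hz)) hz0)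
  obtain ⟨e, d, he, hRe, htot, hsum⟩ := exists_quaternionic_diagonal_basis
    not_finiteDimensional_Hsp isQuatStructure_rightJ hN hRN hθm h0 h1 hL
    (fun z hz w hw hz0 hw0 => hθ z w (hmem z hz hz0) (hmem w hw hw0))
    (ENNReal.ofReal_pos.2 (pow_pos hε 2)).ne'
  have hs : Summable fun r => ‖N (e r) - d r • e r‖ ^ 2 := by
    have h := ENNReal.summable_toReal hsum.ne_top
    simpa only [ENNReal.toReal_ofReal (sq_nonneg _)] using h
  rw [← ENNReal.ofReal_tsum_of_nonneg (fun _ => sq_nonneg _) hs,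
    ENNReal.ofReal_lt_ofReal_iff (pow_pos hε 2)] at hsum
  obtain ⟨D, S, hRD, hRS, hNDS, hD, hS⟩ :=
    exists_diagonal_add_clm isQuatStructure_rightJ hRN he hRe hs
  have hONB := isONBasisOn_univ he hRe htot
  refine ⟨D, S, isBoundedRightLinear_coe hRD, isBoundedRightLinear_coe hRS,
    ⟨e, hONB, fun r => (d r : Hq), hD⟩, ⟨_, ⟨e, hONB, ?_⟩, (Real.sqrt_lt' hε).2 hsum⟩, fun x => ?_⟩
  · simp only [hS]
    exact hs.hasSum
  · rw [hNDS, add_apply]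

end SliceStructure

/-- Let `N ∈ B(H)` be normal, `K ⊆ ℂ_m⁺` compact and contained in a
curve of finite length, with `σ_S(N) = Ω_K`. Then for every `ε > 0` there are a diagonal
`D ∈ B(H)` and a Hilbert–Schmidt `S ∈ B(H)` with `‖S‖₂ < ε` such that `N = D + S`. -/
theorem wvnb_bounded_hilbertSchmidt (m : Hq) (hm : m ∈ QS)
    (N : Hsp → Hsp) (hN : IsBoundedRightLinear N)
    (hnormal : ∃ Ns : Hsp → Hsp, AdjointOf N Ns ∧ ∀ x, Ns (N x) = N (Ns x))
    (K : Set Hq) (hKcompact : IsCompact K) (hKsub : K ⊆ sliceCplus m)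
    (hKcurve : ∃ γ : ℝ → Hq, ContinuousOn γ (Set.Icc 0 1) ∧
      BoundedVariationOn γ (Set.Icc 0 1) ∧ K ⊆ γ '' Set.Icc 0 1)
    (hspec : sphSpectrumB N = circ m K)
    (ε : ℝ) (hε : 0 < ε) :
    ∃ D S : Hsp → Hsp, IsBoundedRightLinear D ∧ IsBoundedRightLinear S ∧
      (∃ e : ℕ → Hsp, IsONBasisOn Set.univ e ∧
        ∃ q : ℕ → Hq, ∀ r, D (e r) = rsmul (q r) (e r)) ∧
      (∃ v : ℝ, HasHSNormSqOn S Set.univ v ∧ Real.sqrt v < ε) ∧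
      (∀ x, N x = D x + S x) := by
  obtain ⟨T, hTN, hRT⟩ := hN.exists_clm
  obtain rfl : N = T := (funext hTN).symm
  obtain ⟨Ns, hadj, hcomm⟩ := hnormal
  obtain ⟨γ, hγ, hγv, hKγ⟩ := hKcurve
  exact exists_diagonal_add_hilbertSchmidt hm hRT (isStarNormal_of_adjointOf hadj hcomm) hKsub
    hγ hγv hKγ hspec.le hε
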